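/- arXiv:1305.5193 — 2 statements merged into one kernel-verified Lean document; each statement's English description precedes it below -/
import Mathlib

section
/- Let Ω ⊂ ℂ be a nonempty bounded simply connected open set, and let ψ be a bounded holomorphic function on Ω with ∫_Ω |ψ'(z)|² dxdy < ∞. Let A²(Ω) denote the closed subspace of L²(Ω, dxdy) consisting of (a.e. equivalence classes of) holomorphic functions, let P : L²(Ω) → A²(Ω) be the orthogonal projection, and define the Toeplitz operator T_ψ : A²(Ω) → A²(Ω) by T_ψ f = P(ψ f). Then the operator norm of the commutator satisfies ‖T_ψ* T_ψ − T_ψ T_ψ*‖ ≤ (1/(2π)) ∫_Ω |ψ'(z)|² dxdy. -/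
open MeasureTheory Complex ContinuousLinearMap

section RiemannMapping

open Filter Metric Set Topology ComplexConjugate

/-- Hurwitz's theorem: near a point where the locally uniform limit `f` is not locally constant,
the approximating functions eventually attain any values converging to the value of `f`. -/
theorem TendstoLocallyUniformlyOn.eventually_exists_eq {ι : Type*} {l : Filter ι}
    {F : ι → ℂ → ℂ} {f : ℂ → ℂ} {U : Set ℂ} (hU : IsOpen U)
    (hF : ∀ᶠ i in l, DifferentiableOn ℂ (F i) U) (hFf : TendstoLocallyUniformlyOn F f l U)
    {a : ℂ} (ha : a ∈ U) (hf : DifferentiableOn ℂ f U) (hfa : ¬ ∀ᶠ z in 𝓝 a, f z = f a)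
    {w : ι → ℂ} (hw : Tendsto w l (𝓝 (f a))) {V : Set ℂ} (hV : V ∈ 𝓝 a) :
    ∀ᶠ i in l, ∃ z ∈ V ∩ U, F i z = w i := by
  have han : AnalyticAt ℂ f a := hf.analyticAt (hU.mem_nhds ha)
  have hne := (han.eventually_eq_or_eventually_ne analyticAt_const).resolve_left hfa
  rw [eventually_nhdsWithin_iff] at hne
  obtain ⟨r, hr, hrs⟩ := Metric.nhds_basis_closedBall.mem_iff.1
    (inter_mem (inter_mem hV (hU.mem_nhds ha)) hne)
  have hrU : closedBall a r ⊆ U := fun z hz => (hrs hz).1.2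
  obtain ⟨ε, hε, hεs⟩ : ∃ ε > 0, ∀ z ∈ sphere a r, ε ≤ ‖f z - f a‖ := by
    refine (isCompact_sphere a r).exists_forall_le' (f := fun z => ‖f z - f a‖) (a := 0) ?_ ?_
    · exact ((hf.continuousOn.mono (sphere_subset_closedBall.trans hrU)).sub
        continuousOn_const).norm
    · intro z hz
      have hza : z ≠ a := by
        rintro rfl
        simp at hz
        exact hr.ne hz
      exact norm_pos_iff.2 (sub_ne_zero.2 ((hrs (sphere_subset_closedBall hz)).2 hza))
  have hunif := (tendstoLocallyUniformlyOn_iff_forall_isCompact hU).1 hFf _ hrU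
    (isCompact_closedBall a r)
  rw [Metric.tendstoUniformlyOn_iff] at hunif
  filter_upwards [hF, hunif (ε / 8) (by positivity),
    (Metric.tendsto_nhds.1 hw) (ε / 8) (by positivity)] with i hi hui hwi
  have hai := hui a (mem_closedBall_self hr.le)
  rw [dist_eq_norm] at hai hwi
  have hs : ∀ z ∈ sphere a r, ε / 2 ≤ ‖F i z - F i a‖ := by
    intro z hz
    have h1 := hui z (sphere_subset_closedBall hz)
    have h2 := hεs z hz
    rw [dist_eq_norm] at h1
    have h3 : f z - f a = (f z - F i z) + (F i z - F i a) - (f a - F i a) := by ring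
    have h4 := norm_sub_le ((f z - F i z) + (F i z - F i a)) (f a - F i a)
    have h5 := norm_add_le (f z - F i z) (F i z - F i a)
    rw [← h3] at h4
    linarith
  have hfreq : ∃ᶠ z in 𝓝 a, F i z ≠ F i a := by
    rw [Filter.Frequently]
    intro hcon
    have heq : EqOn (F i) (fun _ => F i a) (ball a r ∪ sphere a r) := by
      rw [ball_union_sphere]
      have hb : EqOn (F i) (fun _ => F i a) (ball a r) :=
        ((hi.mono (ball_subset_closedBall.trans hrU)).analyticOnNhd
          isOpen_ball).eqOn_of_preconnected_of_eventuallyEq analyticOnNhd_const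
          (convex_ball a r).isPreconnected (mem_ball_self hr)
          (show ∀ᶠ x in 𝓝 a, F i x = F i a by simpa using hcon)
      rw [← closure_ball a hr.ne']
      refine hb.of_subset_closure ?_ continuousOn_const subset_closure subset_rfl
      rw [closure_ball a hr.ne']
      exact hi.continuousOn.mono hrU
    have hz : a + r ∈ sphere a r := by simp [abs_of_pos hr]
    have := hs _ hz
    rw [heq (Or.inr hz)] at this
    simp at this
    linarith
  have hd : DiffContOnCl ℂ (F i) (ball a r) :=
    (hi.mono (by rwa [closure_ball a hr.ne'])).diffContOnCl
  have hsub := hd.ball_subset_image_closedBall hr hs hfreq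
  have hmem : w i ∈ ball (F i a) (ε / 2 / 2) := by
    rw [mem_ball, dist_eq_norm]
    have h3 : w i - F i a = (w i - f a) + (f a - F i a) := by ring
    rw [h3]
    refine (norm_add_le _ _).trans_lt ?_
    linarith
  obtain ⟨z, hz, hzw⟩ := hsub hmem
  exact ⟨z, (hrs hz).1, hzw⟩

/-- Montel's theorem along an ultrafilter. -/
theorem exists_tendstoLocallyUniformlyOn_ultrafilter {ι : Type*} (l : Ultrafilter ι)
    {F : ι → ℂ → ℂ} {U : Set ℂ} (hU : IsOpen U) (hF : ∀ i, DifferentiableOn ℂ (F i) U)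
    (hb : ∀ i, MapsTo (F i) U (ball 0 1)) :
    ∃ f : ℂ → ℂ, TendstoLocallyUniformlyOn F f l U := by
  have hlim : ∀ z, ∃ w, z ∈ U → Tendsto (fun i => F i z) l (𝓝 w) := by
    intro z
    by_cases hz : z ∈ U
    · obtain ⟨w, -, hw⟩ := (isCompact_closedBall (0 : ℂ) 1).ultrafilter_le_nhds
        (l.map fun i => F i z) (by
          rw [le_principal_iff]
          exact Filter.mem_map.2 (Eventually.of_forall fun i => ball_subset_closedBall (hb i hz)))
      exact ⟨w, fun _ => hw⟩
    · exact ⟨0, fun h => (hz h).elim⟩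
  choose f hf using hlim
  refine ⟨f, Metric.tendstoLocallyUniformlyOn_iff.2 fun ε hε x hx => ?_⟩
  obtain ⟨r, hr, hrU⟩ := Metric.isOpen_iff.1 hU x hx
  have hlip : ∀ i, ∀ z ∈ ball x r, dist (F i z) (F i x) ≤ 2 / r * dist z x := by
    intro i z hz
    refine dist_le_div_mul_dist_of_mapsTo_ball ((hF i).mono hrU) (fun y hy => ?_) hz
    rw [mem_closedBall]
    have h1 := hb i (hrU hy)
    have h2 := hb i hx
    rw [mem_ball_zero_iff] at h1 h2
    exact (dist_le_norm_add_norm _ _).trans (by linarith)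
  have hd : ∀ᶠ z in 𝓝 x, 2 / r * dist z x < ε / 3 := by
    have : Tendsto (fun z => 2 / r * dist z x) (𝓝 x) (𝓝 0) := by
      have : Continuous fun z => 2 / r * dist z x := by fun_prop
      simpa using this.tendsto x
    exact this.eventually_lt_const (by positivity)
  refine ⟨U ∩ (ball x r ∩ {z | 2 / r * dist z x < ε / 3}),
    mem_nhdsWithin_of_mem_nhds (inter_mem (hU.mem_nhds hx) (inter_mem (ball_mem_nhds x hr) hd)), ?_⟩
  filter_upwards [(Metric.tendsto_nhds.1 (hf x hx)) (ε / 3) (by positivity)] with i hi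
  rintro z ⟨hzU, hzr, hzd⟩
  have h1 := hlip i z hzr
  have h2 : dist (f z) (f x) ≤ ε / 3 :=
    le_of_tendsto ((hf z hzU).dist (hf x hx))
      (Eventually.of_forall fun j => (hlip j z hzr).trans (le_of_lt hzd))
  have h3 := dist_triangle4 (f z) (f x) (F i x) (F i z)
  rw [dist_comm (f x) (F i x), dist_comm (F i x) (F i z)] at h3
  have h4 : 2 / r * dist z x < ε / 3 := hzd
  linarith

/-- An injective map of `U` into the unit disk with nowhere vanishing complex derivative. -/
structure IsDiskEmbedding (U : Set ℂ) (f : ℂ → ℂ) : Prop where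
  mapsTo : MapsTo f U (ball 0 1)
  injOn : InjOn f U
  deriv_ne_zero : ∀ z ∈ U, deriv f z ≠ 0

namespace IsDiskEmbedding

variable {U : Set ℂ} {f : ℂ → ℂ}

theorem hasDerivAt (hf : IsDiskEmbedding U f) {z : ℂ} (hz : z ∈ U) :
    HasDerivAt f (deriv f z) z :=
  (differentiableAt_of_deriv_ne_zero (hf.deriv_ne_zero z hz)).hasDerivAt

theorem differentiableOn (hf : IsDiskEmbedding U f) : DifferentiableOn ℂ f U :=
  fun _ hz => (hf.hasDerivAt hz).differentiableAt.differentiableWithinAt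

theorem norm_deriv_le (hf : IsDiskEmbedding U f) {z : ℂ} {r : ℝ} (hr : 0 < r)
    (hzr : ball z r ⊆ U) : ‖deriv f z‖ ≤ 2 / r := by
  refine norm_deriv_le_div_of_mapsTo_ball (hf.differentiableOn.mono hzr) (fun y hy => ?_) hr
  have h1 := hf.mapsTo (hzr hy)
  have h2 := hf.mapsTo (hzr (mem_ball_self hr))
  rw [mem_ball_zero_iff] at h1 h2
  rw [mem_closedBall]
  exact (dist_le_norm_add_norm _ _).trans (by linarith)

end IsDiskEmbedding

/-- The disk automorphism exchanging `a` and `0` up to sign. -/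
noncomputable def diskMobius (a w : ℂ) : ℂ := (w - a) / (1 - conj a * w)

theorem one_sub_conj_mul_ne_zero {a w : ℂ} (ha : ‖a‖ < 1) (hw : ‖w‖ < 1) :
    1 - conj a * w ≠ 0 := by
  intro h
  have h1 : ‖conj a * w‖ = 1 := by rw [← sub_eq_zero.1 h, norm_one]
  rw [norm_mul, RCLike.norm_conj] at h1
  nlinarith [norm_nonneg a, norm_nonneg w]

theorem hasDerivAt_diskMobius {a w : ℂ} (ha : ‖a‖ < 1) (hw : ‖w‖ < 1) :
    HasDerivAt (diskMobius a) ((1 - conj a * a) / (1 - conj a * w) ^ 2) w := by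
  have h1 : HasDerivAt (fun w => w - a) 1 w := (hasDerivAt_id w).sub_const a
  have h2 : HasDerivAt (fun w => 1 - conj a * w) (-(conj a)) w := by
    simpa using ((hasDerivAt_id w).const_mul (conj a)).const_sub 1
  have h3 := h1.div h2 (one_sub_conj_mul_ne_zero ha hw)
  have h4 : 1 * (1 - conj a * w) - (w - a) * -conj a = 1 - conj a * a := by ring
  rwa [h4] at h3

theorem norm_diskMobius_lt_one {a w : ℂ} (ha : ‖a‖ < 1) (hw : ‖w‖ < 1) :
    ‖diskMobius a w‖ < 1 := by
  rw [diskMobius, norm_div, div_lt_one (norm_pos_iff.2 (one_sub_conj_mul_ne_zero ha hw))]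
  refine lt_of_pow_lt_pow_left₀ 2 (norm_nonneg _) ?_
  have key : normSq (1 - conj a * w) - normSq (w - a) = (1 - normSq a) * (1 - normSq w) := by
    simp only [normSq_apply, sub_re, sub_im, mul_re, mul_im, conj_re, conj_im, one_re, one_im]
    ring
  have h1 : normSq a < 1 := by rw [normSq_eq_norm_sq]; nlinarith [norm_nonneg a]
  have h2 : normSq w < 1 := by rw [normSq_eq_norm_sq]; nlinarith [norm_nonneg w]
  rw [← normSq_eq_norm_sq, ← normSq_eq_norm_sq]
  nlinarith

theorem injOn_diskMobius {a : ℂ} (ha : ‖a‖ < 1) : InjOn (diskMobius a) (ball 0 1) := by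
  intro x hx y hy h
  rw [mem_ball_zero_iff] at hx hy
  rw [diskMobius, diskMobius, div_eq_div_iff (one_sub_conj_mul_ne_zero ha hx)
    (one_sub_conj_mul_ne_zero ha hy)] at h
  have h1 : (1 - conj a * a) * (x - y) = 0 := by linear_combination h
  exact sub_eq_zero.1 ((mul_eq_zero.1 h1).resolve_left (one_sub_conj_mul_ne_zero ha ha))

namespace IsDiskEmbedding

variable {U : Set ℂ} {f : ℂ → ℂ}

theorem hasDerivAt_diskMobius_comp (hf : IsDiskEmbedding U f) {a : ℂ} (ha : ‖a‖ < 1) {z : ℂ}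
    (hz : z ∈ U) :
    HasDerivAt (diskMobius a ∘ f)
      ((1 - conj a * a) / (1 - conj a * f z) ^ 2 * deriv f z) z :=
  (hasDerivAt_diskMobius ha (mem_ball_zero_iff.1 (hf.mapsTo hz))).comp z (hf.hasDerivAt hz)

theorem diskMobius_comp (hf : IsDiskEmbedding U f) {a : ℂ} (ha : ‖a‖ < 1) :
    IsDiskEmbedding U (diskMobius a ∘ f) where
  mapsTo z hz := mem_ball_zero_iff.2
    (norm_diskMobius_lt_one ha (mem_ball_zero_iff.1 (hf.mapsTo hz)))
  injOn := (injOn_diskMobius ha).comp hf.injOn hf.mapsTo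
  deriv_ne_zero z hz := by
    rw [(hf.hasDerivAt_diskMobius_comp ha hz).deriv]
    exact mul_ne_zero (div_ne_zero (one_sub_conj_mul_ne_zero ha ha)
      (pow_ne_zero 2 (one_sub_conj_mul_ne_zero ha (mem_ball_zero_iff.1 (hf.mapsTo hz)))))
      (hf.deriv_ne_zero z hz)

theorem norm_deriv_diskMobius_comp (hf : IsDiskEmbedding U f) {z : ℂ} (hz : z ∈ U) :
    ‖deriv (diskMobius (f z) ∘ f) z‖ = ‖deriv f z‖ / (1 - ‖f z‖ ^ 2) := by
  have ha : ‖f z‖ < 1 := mem_ball_zero_iff.1 (hf.mapsTo hz)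
  have hpos : 0 < 1 - ‖f z‖ ^ 2 := by nlinarith [norm_nonneg (f z)]
  rw [(hf.hasDerivAt_diskMobius_comp ha hz).deriv, conj_mul']
  have : (1 - (‖f z‖ : ℂ) ^ 2) = ((1 - ‖f z‖ ^ 2 : ℝ) : ℂ) := by push_cast; ring
  rw [this, norm_mul, norm_div, norm_pow, norm_real, Real.norm_of_nonneg hpos.le]
  field_simp

/-- Koebe's square root trick. -/
theorem exists_norm_deriv_lt (hU : IsOpen U) (hUc : IsSimplyConnected U)
    (hf : IsDiskEmbedding U f) {z₀ : ℂ} (hz₀ : z₀ ∈ U) (hfz₀ : f z₀ = 0) {c : ℂ} (hc : ‖c‖ < 1)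
    (hcU : c ∉ f '' U) : ∃ g, IsDiskEmbedding U g ∧ ‖deriv f z₀‖ < ‖deriv g z₀‖ := by
  set p := diskMobius c ∘ f with hp
  have hpe : IsDiskEmbedding U p := hf.diskMobius_comp hc
  have hp0 : ∀ z ∈ U, p z ≠ 0 := by
    intro z hz h0
    rcases div_eq_zero_iff.1 h0 with h | h
    · exact hcU ⟨z, hz, sub_eq_zero.1 h⟩
    · exact one_sub_conj_mul_ne_zero hc (mem_ball_zero_iff.1 (hf.mapsTo hz)) h
  obtain ⟨s, hsc, hs⟩ := exists_continuousOn_pow_eq hUc hU hpe.differentiableOn.continuousOn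
    (by rintro ⟨z, hz, h⟩; exact hp0 z hz h) two_ne_zero
  have hs0 : ∀ z ∈ U, s z ≠ 0 := by
    intro z hz h
    apply hp0 z hz
    rw [← hs z, h]
    simp
  have hsd : ∀ z ∈ U, HasDerivAt s ((2 * s z)⁻¹ * deriv p z) z := by
    intro z hz
    have h2 : HasStrictDerivAt (fun y : ℂ => y ^ 2) (2 * s z) (s z) := by
      simpa using hasStrictDerivAt_pow 2 (s z)
    have hne : 2 * s z ≠ 0 := mul_ne_zero two_ne_zero (hs0 z hz)
    have hinv := (h2.to_localInverse hne).hasDerivAt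
    simp only [hs] at hinv
    refine (hinv.comp z (hpe.hasDerivAt hz)).congr_of_eventuallyEq ?_
    have hev := (h2.hasStrictFDerivAt_equiv hne).eventually_left_inverse
    filter_upwards [(hsc.continuousAt (hU.mem_nhds hz)).eventually hev] with y hy
    simp only [hs] at hy
    exact hy.symm
  have hse : IsDiskEmbedding U s := by
    refine ⟨fun z hz => ?_, fun x hx y hy h => ?_, fun z hz => ?_⟩
    · have h1 := mem_ball_zero_iff.1 (hpe.mapsTo hz)
      rw [← hs z, norm_pow] at h1
      rw [mem_ball_zero_iff]
      by_contra! h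
      nlinarith
    · apply hpe.injOn hx hy
      rw [← hs, ← hs, h]
    · rw [(hsd z hz).deriv]
      exact mul_ne_zero (inv_ne_zero (mul_ne_zero two_ne_zero (hs0 z hz)))
        (hpe.deriv_ne_zero z hz)
  have hs1 : ‖s z₀‖ < 1 := mem_ball_zero_iff.1 (hse.mapsTo hz₀)
  refine ⟨diskMobius (s z₀) ∘ s, hse.diskMobius_comp hs1, ?_⟩
  rw [hse.norm_deriv_diskMobius_comp hz₀, (hsd z₀ hz₀).deriv, hp,
    (hf.hasDerivAt_diskMobius_comp hc hz₀).deriv, hfz₀]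
  have hsq : ‖s z₀‖ ^ 2 = ‖c‖ := by
    rw [← norm_pow, hs, hp, Function.comp_apply, hfz₀]
    simp [diskMobius]
  have hx : 0 < ‖s z₀‖ := norm_pos_iff.2 (hs0 z₀ hz₀)
  have hcc : 1 - conj c * c = ((1 - (‖s z₀‖ ^ 2) ^ 2 : ℝ) : ℂ) := by
    rw [conj_mul', hsq]; push_cast; ring
  have hd : 0 < ‖deriv f z₀‖ := norm_pos_iff.2 (hf.deriv_ne_zero z₀ hz₀)
  have hpos : 0 < 1 - ‖s z₀‖ ^ 2 := by nlinarith
  have hnn : 0 ≤ 1 - (‖s z₀‖ ^ 2) ^ 2 := by nlinarith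
  rw [hcc, norm_mul, norm_mul, norm_inv, norm_mul, norm_div, norm_real, Real.norm_of_nonneg hnn]
  simp only [mul_zero, sub_zero, one_pow, norm_one, div_one, RCLike.norm_ofNat]
  rw [lt_div_iff₀ hpos, ← div_eq_inv_mul, lt_div_iff₀ (by positivity)]
  nlinarith [mul_pos (mul_pos hd hpos) (pow_pos (sub_pos.2 hs1) 2)]

theorem tendsto_of_isPreconnected {ι : Type*} {l : Filter ι} [l.NeBot] {F : ι → ℂ → ℂ}
    (hU : IsOpen U) (hUc : IsPreconnected U) (hF : ∀ i, IsDiskEmbedding U (F i))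
    (hFf : TendstoLocallyUniformlyOn F f l U) {z₀ : ℂ} (hz₀ : z₀ ∈ U) (hd : deriv f z₀ ≠ 0) :
    IsDiskEmbedding U f := by
  have hFd : ∀ᶠ i in l, DifferentiableOn ℂ (F i) U :=
    Eventually.of_forall fun i => (hF i).differentiableOn
  have hfd : DifferentiableOn ℂ f U := hFf.differentiableOn hFd hU
  have hconst : ∀ z ∈ U, ¬ ∀ᶠ y in 𝓝 z, f y = f z := by
    intro z hz h
    have heq : EqOn f (fun _ => f z) U :=
      (hfd.analyticOnNhd hU).eqOn_of_preconnected_of_eventuallyEq analyticOnNhd_const hUc hz h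
    exact hd (((heq.eventuallyEq_of_mem (hU.mem_nhds hz₀)).deriv_eq).trans (by simp))
  have hinj : InjOn f U := by
    intro a ha b hb hab
    by_contra hne
    obtain ⟨V, W, hV, hW, haV, hbW, hVW⟩ := t2_separation hne
    have h1 := hFf.eventually_exists_eq hU hFd ha hfd (hconst a ha)
      (w := fun i => F i b) (by rw [hab]; exact hFf.tendsto_at hb) (hV.mem_nhds haV)
    obtain ⟨i, z, hz, hzb⟩ := h1.exists
    have := (hF i).injOn hz.2 hb hzb
    exact Set.disjoint_left.1 hVW hz.1 (this ▸ hbW)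
  have hderiv : ∀ z ∈ U, deriv f z ≠ 0 := by
    intro z hz h0
    have hD := hFf.deriv hFd hU
    have hDd : DifferentiableOn ℂ (deriv f) U := hfd.deriv hU
    have hnc : ¬ ∀ᶠ y in 𝓝 z, deriv f y = deriv f z := by
      intro h
      have heq : EqOn (deriv f) (fun _ => deriv f z) U :=
        (hDd.analyticOnNhd hU).eqOn_of_preconnected_of_eventuallyEq analyticOnNhd_const hUc hz h
      exact hd ((heq hz₀).trans h0)
    have h1 := hD.eventually_exists_eq hU
      (hFd.mono fun i hi => hi.deriv hU) hz hDd hnc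
      (w := fun _ => 0) (by rw [h0]; exact tendsto_const_nhds) univ_mem
    obtain ⟨i, y, hy, hy0⟩ := h1.exists
    exact (hF i).deriv_ne_zero y hy.2 hy0
  refine ⟨fun z hz => ?_, hinj, hderiv⟩
  have hcl : f '' U ⊆ closedBall 0 1 := by
    rintro _ ⟨y, hy, rfl⟩
    rw [mem_closedBall_zero_iff]
    exact le_of_tendsto (hFf.tendsto_at hy).norm
      (Eventually.of_forall fun i => (mem_ball_zero_iff.1 ((hF i).mapsTo hy)).le)
  have hnhds : f '' U ∈ 𝓝 (f z) := by
    have hs := (hfd.analyticAt (hU.mem_nhds hz)).hasStrictDerivAt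
    rw [← hs.map_nhds_eq (hderiv z hz)]
    exact image_mem_map (hU.mem_nhds hz)
  have := mem_interior_iff_mem_nhds.2 (mem_of_superset hnhds hcl)
  rwa [interior_closedBall _ one_ne_zero] at this

/-- The Riemann mapping theorem for bounded domains. -/
theorem exists_surjOn (hU : IsOpen U) (hUb : Bornology.IsBounded U) (hUc : IsSimplyConnected U) :
    ∃ f, IsDiskEmbedding U f ∧ SurjOn f U (ball 0 1) := by
  have := hUc.simplyConnectedSpace
  obtain ⟨z₀, hz₀⟩ := hUc.nonempty
  have hpre : IsPreconnected U := isPreconnected_iff_preconnectedSpace.2 inferInstance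
  let S : Set ℝ := {d | ∃ f, IsDiskEmbedding U f ∧ ‖deriv f z₀‖ = d}
  have hSne : S.Nonempty := by
    obtain ⟨R, hR, hRU⟩ := hUb.subset_ball_lt 0 0
    have hd : ∀ z : ℂ, HasDerivAt (fun z : ℂ => z / R) (1 / R) z :=
      fun z => (hasDerivAt_id z).div_const _
    have hR0 : (R : ℂ) ≠ 0 := ofReal_ne_zero.2 hR.ne'
    refine ⟨_, fun z => z / R, ⟨fun z hz => ?_, fun x _ y _ h => ?_, fun z _ => ?_⟩, rfl⟩
    · rw [mem_ball_zero_iff, norm_div, norm_real, Real.norm_of_nonneg hR.le, div_lt_one hR]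
      exact mem_ball_zero_iff.1 (hRU hz)
    · exact (div_left_inj' hR0).1 h
    · rw [(hd z).deriv]
      exact one_div_ne_zero hR0
  obtain ⟨r, hr, hrU⟩ := Metric.isOpen_iff.1 hU z₀ hz₀
  have hSb : BddAbove S := by
    refine ⟨2 / r, ?_⟩
    rintro _ ⟨f, hf, rfl⟩
    exact hf.norm_deriv_le hr hrU
  obtain ⟨u, -, hu, huS⟩ := exists_seq_tendsto_sSup hSne hSb
  choose F hF hFu using huS
  let l : Ultrafilter ℕ := hyperfilter ℕ
  have hl : (l : Filter ℕ) ≤ atTop := Nat.hyperfilter_le_atTop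
  obtain ⟨f, hf⟩ := exists_tendstoLocallyUniformlyOn_ultrafilter l hU
    (fun i => (hF i).differentiableOn) (fun i => (hF i).mapsTo)
  have hmax : ‖deriv f z₀‖ = sSup S := by
    have h1 := ((hf.deriv (Eventually.of_forall fun i => (hF i).differentiableOn)
      hU).tendsto_at hz₀).norm
    refine tendsto_nhds_unique h1 ((hu.mono_left hl).congr fun i => (hFu i).symm)
  have hpos : 0 < sSup S := by
    obtain ⟨_, g, hg, rfl⟩ := hSne
    exact (norm_pos_iff.2 (hg.deriv_ne_zero z₀ hz₀)).trans_le (le_csSup hSb ⟨g, hg, rfl⟩)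
  have hfe : IsDiskEmbedding U f :=
    tendsto_of_isPreconnected hU hpre hF hf hz₀ (norm_pos_iff.1 (hmax ▸ hpos))
  have hle : ∀ g, IsDiskEmbedding U g → ‖deriv g z₀‖ ≤ ‖deriv f z₀‖ :=
    fun g hg => hmax ▸ le_csSup hSb ⟨g, hg, rfl⟩
  have hf0 : f z₀ = 0 := by
    by_contra h0
    have h1 : ‖f z₀‖ < 1 := mem_ball_zero_iff.1 (hfe.mapsTo hz₀)
    have h2 := hle _ (hfe.diskMobius_comp h1)
    rw [hfe.norm_deriv_diskMobius_comp hz₀] at h2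
    have h3 : 0 < ‖f z₀‖ := norm_pos_iff.2 h0
    have h4 : 0 < 1 - ‖f z₀‖ ^ 2 := by nlinarith
    rw [div_le_iff₀ h4] at h2
    have h5 : 0 < ‖deriv f z₀‖ := hmax ▸ hpos
    nlinarith [mul_pos h5 (pow_pos h3 2)]
  refine ⟨f, hfe, fun c hc => ?_⟩
  by_contra hcU
  obtain ⟨g, hg, hlt⟩ := hfe.exists_norm_deriv_lt hU hUc hz₀ hf0 (mem_ball_zero_iff.1 hc) hcU
  exact hlt.not_ge (hle g hg)

theorem exists_inverse (hU : IsOpen U) (hf : IsDiskEmbedding U f)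
    (hs : SurjOn f U (ball 0 1)) :
    ∃ g : ℂ → ℂ, MapsTo g (ball 0 1) U ∧ (∀ w ∈ ball (0 : ℂ) 1, f (g w) = w) ∧
      (∀ z ∈ U, g (f z) = z) ∧ ∀ w ∈ ball (0 : ℂ) 1, HasDerivAt g (deriv f (g w))⁻¹ w := by
  refine ⟨Function.invFunOn f U, hs.mapsTo_invFunOn, hs.rightInvOn_invFunOn,
    hf.injOn.leftInvOn_invFunOn, fun w hw => ?_⟩
  have hgU := hs.mapsTo_invFunOn hw
  have hfg : f (Function.invFunOn f U w) = w := hs.rightInvOn_invFunOn hw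
  set z := Function.invFunOn f U w with hz
  have hst := (hf.differentiableOn.analyticAt (hU.mem_nhds hgU)).hasStrictDerivAt
  have hne := hf.deriv_ne_zero z hgU
  have hcont : ContinuousAt (Function.invFunOn f U) w := by
    intro V hV
    rw [← hz] at hV
    rw [Filter.mem_map, ← hfg, ← hst.map_nhds_eq hne, Filter.mem_map]
    filter_upwards [hV, hU.mem_nhds hgU] with y hy hyU
    rw [mem_preimage, mem_preimage, hf.injOn.leftInvOn_invFunOn hyU]
    exact hy
  refine (HasStrictDerivAt.of_local_left_inverse hcont (by rwa [← hz]) hne ?_).hasDerivAt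
  filter_upwards [isOpen_ball.mem_nhds hw] with y hy
  exact hs.rightInvOn_invFunOn hy

end IsDiskEmbedding

end RiemannMapping

section DiskIntegrals

open Filter Metric Set Topology ComplexConjugate

theorem Continuous.integrableOn_ball {E : Type*} [NormedAddCommGroup E] {u : ℂ → E}
    (hu : Continuous u) (r : ℝ) : IntegrableOn u (ball 0 r) :=
  (hu.continuousOn.integrableOn_compact (isCompact_closedBall 0 r)).mono_set ball_subset_closedBall

theorem integral_ball_pow_mul_conj_pow {r : ℝ} (hr : 0 ≤ r) (p q : ℕ) :
    ∫ z in ball (0 : ℂ) r, z ^ p * conj z ^ q =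
      if p = q then ((Real.pi * r ^ (2 * p + 2) / (p + 1) : ℝ) : ℂ) else 0 := by
  rw [← integral_indicator measurableSet_ball, ← Complex.integral_comp_polarCoord_symm]
  have hcongr : ∀ x ∈ polarCoord.target,
      x.1 • (ball (0 : ℂ) r).indicator (fun z => z ^ p * conj z ^ q) (Complex.polarCoord.symm x) =
        (Iio r).indicator (fun t : ℝ => ((t ^ (p + q + 1) : ℝ) : ℂ)) x.1 *
          cexp (((p : ℂ) - q) * I * x.2) := by
    rintro ⟨t, θ⟩ ⟨ht, hθ⟩
    have ht0 : 0 < t := ht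
    have hz : Complex.polarCoord.symm (t, θ) = t * cexp (θ * I) := by
      rw [Complex.polarCoord_symm_apply, exp_mul_I, ofReal_cos, ofReal_sin]
    have hn : ‖(t : ℂ) * cexp (θ * I)‖ = t := by
      rw [norm_mul, norm_exp_ofReal_mul_I, norm_real, Real.norm_of_nonneg ht0.le, mul_one]
    rw [hz]
    by_cases h : t < r
    · rw [indicator_of_mem (by rwa [mem_ball_zero_iff, hn]), indicator_of_mem (by exact h)]
      have hc : conj (cexp (θ * I)) = cexp (-(θ * I)) := by
        rw [← exp_conj]; simp
      have he : cexp (((p : ℂ) - q) * I * θ) = cexp (θ * I) ^ p * cexp (-(θ * I)) ^ q := by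
        rw [← exp_nat_mul, ← exp_nat_mul, ← exp_add]
        congr 1
        ring
      rw [he, map_mul, hc, conj_ofReal, real_smul]
      push_cast
      ring
    · rw [indicator_of_notMem (by rwa [mem_ball_zero_iff, hn]), indicator_of_notMem (by exact h)]
      simp
  rw [setIntegral_congr_fun polarCoord.open_target.measurableSet hcongr, polarCoord_target,
    Measure.volume_eq_prod,
    setIntegral_prod_mul (fun t : ℝ => (Iio r).indicator
      (fun t : ℝ => ((t ^ (p + q + 1) : ℝ) : ℂ)) t) (fun θ : ℝ => cexp (((p : ℂ) - q) * I * θ)),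
    setIntegral_indicator measurableSet_Iio, Ioi_inter_Iio, integral_complex_ofReal,
    ← integral_Ioc_eq_integral_Ioo, ← integral_Ioc_eq_integral_Ioo,
    ← intervalIntegral.integral_of_le hr,
    ← intervalIntegral.integral_of_le (by linarith [Real.pi_pos]), integral_pow]
  split_ifs with h
  · subst h
    simp only [sub_self, zero_mul, exp_zero, intervalIntegral.integral_const]
    have h1 : ((p : ℂ) + 1) ≠ 0 := by exact_mod_cast p.succ_ne_zero
    rw [show p + p + 1 + 1 = 2 * p + 2 by ring]
    simp only [real_smul]
    push_cast
    rw [zero_pow (by omega), show (p : ℂ) + p + 1 + 1 = 2 * (p + 1) by ring]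
    field_simp
    ring
  · have hk : ((p : ℂ) - q) * I ≠ 0 :=
      mul_ne_zero (sub_ne_zero.2 (by exact_mod_cast h)) I_ne_zero
    have hper : cexp (((p : ℂ) - q) * I * (Real.pi : ℝ)) =
        cexp (((p : ℂ) - q) * I * (-Real.pi : ℝ)) := by
      rw [exp_eq_exp_iff_exists_int]
      refine ⟨p - q, ?_⟩
      push_cast
      ring
    rw [integral_exp_mul_complex hk, hper]
    simp

theorem ofReal_integral_ball_norm_sum_sq {ι : Type*} (s : Finset ι) {R : ι → ℂ → ℂ}
    (hR : ∀ i, Continuous (R i)) (c : ι → ℂ) (r : ℝ) :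
    ((∫ z in ball (0 : ℂ) r, ‖∑ i ∈ s, c i * R i z‖ ^ 2 : ℝ) : ℂ) =
      ∑ i ∈ s, ∑ j ∈ s, c i * conj (c j) * ∫ z in ball (0 : ℂ) r, R i z * conj (R j z) := by
  rw [← integral_complex_ofReal]
  have h : ∀ z : ℂ, ((‖∑ i ∈ s, c i * R i z‖ ^ 2 : ℝ) : ℂ) =
      ∑ i ∈ s, ∑ j ∈ s, c i * conj (c j) * (R i z * conj (R j z)) := by
    intro z
    rw [ofReal_pow, ← mul_conj', map_sum, Finset.sum_mul_sum]
    refine Finset.sum_congr rfl fun i _ => Finset.sum_congr rfl fun j _ => ?_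
    rw [map_mul]
    ring
  simp_rw [h]
  have hc : ∀ i j, Continuous fun z => c i * conj (c j) * (R i z * conj (R j z)) := by
    intro i j
    have := hR i
    have := hR j
    fun_prop
  rw [integral_finsetSum _ fun i _ =>
    (continuous_finsetSum _ fun j _ => hc i j).integrableOn_ball r]
  refine Finset.sum_congr rfl fun i _ => ?_
  rw [integral_finsetSum _ fun j _ => (hc i j).integrableOn_ball r]
  exact Finset.sum_congr rfl fun j _ => integral_const_mul _ _

theorem integral_ball_norm_sum_pow_sq {r : ℝ} (hr : 0 ≤ r) (s : Finset ℕ) (a : ℕ → ℂ) :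
    ∫ z in ball (0 : ℂ) r, ‖∑ n ∈ s, a n * z ^ n‖ ^ 2 =
      ∑ n ∈ s, ‖a n‖ ^ 2 * (Real.pi * r ^ (2 * n + 2) / (n + 1)) := by
  apply ofReal_injective
  rw [ofReal_integral_ball_norm_sum_sq s (R := fun n z => z ^ n) (fun n => by fun_prop)]
  simp only [map_pow, integral_ball_pow_mul_conj_pow hr, mul_ite, mul_zero, ofReal_sum]
  refine Finset.sum_congr rfl fun n hn => ?_
  rw [Finset.sum_ite_eq, if_pos hn, mul_conj', ofReal_mul, ofReal_pow]

/-- Parseval's identity on a smaller disk. -/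
theorem tendsto_sum_integral_ball_norm_sq {g : ℂ → ℂ} {a : ℕ → ℂ}
    (hg : ∀ z ∈ ball (0 : ℂ) 1, HasSum (fun n => a n * z ^ n) (g z)) {r : ℝ} (hr : 0 ≤ r)
    (hr1 : r < 1) :
    Tendsto (fun N => ∑ n ∈ Finset.range N, ‖a n‖ ^ 2 * (Real.pi * r ^ (2 * n + 2) / (n + 1)))
      atTop (𝓝 (∫ z in ball (0 : ℂ) r, ‖g z‖ ^ 2)) := by
  simp_rw [← integral_ball_norm_sum_pow_sq hr]
  have hs : Summable fun n => ‖a n‖ * r ^ n := by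
    have := (hg r (by simpa [abs_of_nonneg hr] using hr1)).summable.norm
    simpa [abs_of_nonneg hr] using this
  refine tendsto_integral_of_dominated_convergence
    (fun _ => (∑' n, ‖a n‖ * r ^ n) ^ 2) (fun N => ?_) ?_ (fun N => ?_) ?_
  · exact (Continuous.aestronglyMeasurable (by fun_prop))
  · exact continuous_const.integrableOn_ball r
  · filter_upwards [ae_restrict_mem measurableSet_ball] with z hz
    rw [mem_ball_zero_iff] at hz
    rw [Real.norm_of_nonneg (by positivity)]
    gcongr
    refine (norm_sum_le _ _).trans (le_trans ?_ (hs.sum_le_tsum (Finset.range N)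
      fun n _ => by positivity))
    refine Finset.sum_le_sum fun n _ => ?_
    rw [norm_mul, norm_pow]
    gcongr
  · filter_upwards [ae_restrict_mem measurableSet_ball] with z hz
    exact ((hg z (ball_subset_ball hr1.le hz)).tendsto_sum_nat.norm).pow 2

/-- Bessel's inequality in the Bergman space of the unit disk. -/
theorem sum_le_integral_ball_norm_sq {g : ℂ → ℂ} {a : ℕ → ℂ}
    (hg : ∀ z ∈ ball (0 : ℂ) 1, HasSum (fun n => a n * z ^ n) (g z))
    (hgi : IntegrableOn (fun z => ‖g z‖ ^ 2) (ball 0 1)) (N : ℕ) :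
    ∑ n ∈ Finset.range N, ‖a n‖ ^ 2 * (Real.pi / (n + 1)) ≤ ∫ z in ball (0 : ℂ) 1, ‖g z‖ ^ 2 := by
  have hc : Continuous fun r : ℝ =>
      ∑ n ∈ Finset.range N, ‖a n‖ ^ 2 * (Real.pi * r ^ (2 * n + 2) / (n + 1)) := by
    fun_prop
  have ht := (hc.tendsto 1).mono_left (nhdsWithin_le_nhds (s := Iio 1))
  simp only [one_pow, mul_one] at ht
  refine le_of_tendsto ht ?_
  filter_upwards [Ioo_mem_nhdsLT (zero_lt_one' ℝ)] with r hr
  have hmono : Monotone fun N => ∑ n ∈ Finset.range N,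
      ‖a n‖ ^ 2 * (Real.pi * r ^ (2 * n + 2) / (n + 1)) :=
    monotone_nat_of_le_succ fun n => by
      rw [Finset.sum_range_succ]
      have := hr.1
      have : 0 ≤ ‖a n‖ ^ 2 * (Real.pi * r ^ (2 * n + 2) / (n + 1)) := by positivity
      linarith
  refine (hmono.ge_of_tendsto (tendsto_sum_integral_ball_norm_sq hg hr.1.le hr.2) N).trans ?_
  exact setIntegral_mono_set hgi (Eventually.of_forall fun z => by positivity)
    (ball_subset_ball hr.2.le).eventuallyLE

theorem setLIntegral_ball_enorm_sq_le {g : ℂ → ℂ} {a : ℕ → ℂ}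
    (hg : ∀ z ∈ ball (0 : ℂ) 1, HasSum (fun n => a n * z ^ n) (g z))
    (hgc : ContinuousOn g (ball 0 1)) {C : ℝ}
    (hC : ∀ N, ∑ n ∈ Finset.range N, ‖a n‖ ^ 2 * (Real.pi / (n + 1)) ≤ C) :
    ∫⁻ z in ball (0 : ℂ) 1, ‖g z‖ₑ ^ 2 ≤ ENNReal.ofReal C := by
  obtain ⟨u, hu, hu1, hut⟩ := exists_seq_strictMono_tendsto' (zero_lt_one' ℝ)
  have hU : ball (0 : ℂ) 1 = ⋃ k, ball (0 : ℂ) (u k) := by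
    refine Subset.antisymm (fun z hz => ?_) (iUnion_subset fun k => ball_subset_ball (hu1 k).2.le)
    obtain ⟨k, hk⟩ := (hut.eventually_const_lt (mem_ball_zero_iff.1 hz)).exists
    exact mem_iUnion.2 ⟨k, mem_ball_zero_iff.2 hk⟩
  rw [hU, setLIntegral_iUnion_of_directed _
    (Monotone.directed_le fun i j h => ball_subset_ball (hu.monotone h))]
  refine iSup_le fun k => ?_
  have hcont : ContinuousOn (fun z => ‖g z‖ ^ 2) (closedBall 0 (u k)) :=
    ((hgc.mono (closedBall_subset_ball (hu1 k).2)).norm).pow 2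
  have hint : IntegrableOn (fun z => ‖g z‖ ^ 2) (ball 0 (u k)) :=
    (hcont.integrableOn_compact (isCompact_closedBall 0 _)).mono_set ball_subset_closedBall
  have h1 : ∫⁻ z in ball (0 : ℂ) (u k), ‖g z‖ₑ ^ 2 =
      ENNReal.ofReal (∫ z in ball (0 : ℂ) (u k), ‖g z‖ ^ 2) := by
    rw [ofReal_integral_eq_lintegral_ofReal hint (Eventually.of_forall fun z => by positivity)]
    refine lintegral_congr fun z => ?_
    rw [ENNReal.ofReal_pow (norm_nonneg _), ofReal_norm]
  rw [h1]
  refine ENNReal.ofReal_le_ofReal (le_of_tendsto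
    (tendsto_sum_integral_ball_norm_sq hg (hu1 k).1.le (hu1 k).2)
    (Eventually.of_forall fun N => le_trans (Finset.sum_le_sum fun n _ => ?_) (hC N)))
  have h0 := (hu1 k).1.le
  have : u k ^ (2 * n + 2) ≤ 1 := pow_le_one₀ h0 (hu1 k).2.le
  have hpi := Real.pi_pos
  gcongr
  nlinarith

/-- Taylor polynomials converge in the Bergman space of the unit disk. -/
theorem exists_setLIntegral_sub_sum_le {g : ℂ → ℂ} {a : ℕ → ℂ}
    (hg : ∀ z ∈ ball (0 : ℂ) 1, HasSum (fun n => a n * z ^ n) (g z))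
    (hgc : ContinuousOn g (ball 0 1))
    (hgi : IntegrableOn (fun z => ‖g z‖ ^ 2) (ball 0 1)) {ε : ℝ} (hε : 0 < ε) :
    ∃ N, ∫⁻ z in ball (0 : ℂ) 1, ‖g z - ∑ n ∈ Finset.range N, a n * z ^ n‖ₑ ^ 2 ≤
      ENNReal.ofReal ε := by
  have hnn : ∀ n : ℕ, 0 ≤ ‖a n‖ ^ 2 * (Real.pi / (n + 1)) := fun n => by positivity
  have hsum : Summable fun n : ℕ => ‖a n‖ ^ 2 * (Real.pi / (n + 1)) :=
    summable_of_sum_range_le hnn (sum_le_integral_ball_norm_sq hg hgi)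
  obtain ⟨N, hN⟩ := ((tendsto_sum_nat_add fun n : ℕ =>
    ‖a n‖ ^ 2 * (Real.pi / (n + 1))).eventually_le_const hε).exists
  refine ⟨N, setLIntegral_ball_enorm_sq_le (a := fun n => if n < N then 0 else a n) ?_ ?_ ?_⟩
  · intro z hz
    have h1 : HasSum (fun n => if n ∈ Finset.range N then a n * z ^ n else 0)
        (∑ n ∈ Finset.range N, if n ∈ Finset.range N then a n * z ^ n else 0) :=
      hasSum_sum_of_ne_finset_zero fun n hn => if_neg hn
    rw [Finset.sum_congr rfl fun n hn => if_pos hn] at h1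
    have h2 : (fun n => (if n < N then 0 else a n) * z ^ n) =
        fun n => a n * z ^ n - if n ∈ Finset.range N then a n * z ^ n else 0 := by
      funext n
      simp only [Finset.mem_range]
      split_ifs <;> simp
    rw [h2]
    exact (hg z hz).sub h1
  · exact hgc.sub (by fun_prop)
  · intro M
    refine le_trans ?_ hN
    have h2 := (summable_nat_add_iff N).2 hsum
    rcases le_total M N with hMN | hMN
    · rw [Finset.sum_eq_zero fun n hn => ?_]
      · exact tsum_nonneg fun n => hnn _
      · rw [if_pos ((Finset.mem_range.1 hn).trans_le hMN)]; simp
    · obtain ⟨k, rfl⟩ := Nat.exists_eq_add_of_le hMN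
      rw [Finset.sum_range_add, Finset.sum_eq_zero fun n hn => ?_, zero_add]
      · refine le_trans (le_of_eq ?_) (h2.sum_le_tsum (Finset.range k) fun n _ => hnn _)
        refine Finset.sum_congr rfl fun n _ => ?_
        rw [if_neg (by omega), add_comm N n]
      · rw [if_pos (Finset.mem_range.1 hn)]; simp

end DiskIntegrals

section HankelOnMonomials

open Filter Metric Set Topology ComplexConjugate

/-- For `i = (n, m)`, the coefficient of `z ^ (n - m)` in the Bergman projection of
`z ^ n * conj z ^ m` on the unit disk. -/
noncomputable def bergmanProjCoeff (i : ℕ × ℕ) : ℝ :=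
  if i.2 ≤ i.1 then ((i.1 : ℝ) - i.2 + 1) / (i.1 + 1) else 0

/-- For `i = (n, m)`, the Hankel operator with symbol `conj z ^ m` applied to `z ^ n`. -/
noncomputable def hankelMonomial (i : ℕ × ℕ) (z : ℂ) : ℂ :=
  z ^ i.1 * conj z ^ i.2 - bergmanProjCoeff i * z ^ (i.1 - i.2)

/-- The nonzero inner products of the functions `hankelMonomial i`, divided by `π`. -/
noncomputable def hankelGram (i j : ℕ × ℕ) : ℝ :=
  if i.2 ≤ i.1 then (i.2 * j.2 : ℝ) / ((i.1 + j.2 + 1) * (i.1 + 1) * (j.1 + 1))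
  else 1 / (i.1 + j.2 + 1)

theorem continuous_hankelMonomial (i : ℕ × ℕ) : Continuous (hankelMonomial i) := by
  unfold hankelMonomial
  fun_prop

theorem hankelGram_nonneg (i j : ℕ × ℕ) : 0 ≤ hankelGram i j := by
  unfold hankelGram
  split_ifs <;> positivity

theorem hankelGram_comm {i j : ℕ × ℕ} (h : i.1 + j.2 = j.1 + i.2) :
    hankelGram i j = hankelGram j i := by
  have h' : (i.1 : ℝ) + j.2 = j.1 + i.2 := by exact_mod_cast h
  unfold hankelGram
  rw [h']
  split_ifs
  · ring
  · omega
  · omega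
  · rfl

theorem integral_hankelMonomial_mul_conj (i j : ℕ × ℕ) :
    ∫ z in ball (0 : ℂ) 1, hankelMonomial i z * conj (hankelMonomial j z) =
      if i.1 + j.2 = j.1 + i.2 then ((Real.pi * hankelGram i j : ℝ) : ℂ) else 0 := by
  obtain ⟨n, m⟩ := i
  obtain ⟨k, l⟩ := j
  have hexp : ∀ z : ℂ, hankelMonomial (n, m) z * conj (hankelMonomial (k, l) z) =
      z ^ (n + l) * conj z ^ (m + k) - bergmanProjCoeff (k, l) * (z ^ n * conj z ^ (m + (k - l)))
        - bergmanProjCoeff (n, m) * (z ^ (n - m + l) * conj z ^ k)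
        + bergmanProjCoeff (n, m) * bergmanProjCoeff (k, l) *
          (z ^ (n - m) * conj z ^ (k - l)) := by
    intro z
    simp only [hankelMonomial, map_sub, map_mul, map_pow, conj_conj, conj_ofReal]
    ring
  simp_rw [hexp]
  rw [integral_add, integral_sub, integral_sub]
  rotate_left
  iterate 6 exact Continuous.integrableOn_ball (by fun_prop) 1
  simp only [integral_const_mul, integral_ball_pow_mul_conj_pow zero_le_one]
  simp only [bergmanProjCoeff, hankelGram, one_pow, mul_one]
  by_cases hmn : m ≤ n <;> by_cases hlk : l ≤ k
  · obtain ⟨d, rfl⟩ := Nat.exists_eq_add_of_le hmn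
    obtain ⟨e, rfl⟩ := Nat.exists_eq_add_of_le hlk
    by_cases hde : d = e
    · subst hde
      simp only [hmn, hlk, if_true, Nat.add_sub_cancel_left]
      rw [if_pos (show m + d + l = m + (l + d) by omega), if_pos (show d + l = l + d by omega),
        if_pos (show m + d + l = l + d + m by omega),
        show ((m + d : ℕ) : ℝ) - m = d by push_cast; ring,
        show ((l + d : ℕ) : ℝ) - l = d by push_cast; ring]
      norm_cast
      push_cast
      have h1 : (m : ℝ) + d + 1 ≠ 0 := by positivity
      have h2 : (l : ℝ) + d + 1 ≠ 0 := by positivity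
      have h3 : (m : ℝ) + d + l + 1 ≠ 0 := by positivity
      have h4 : (d : ℝ) + 1 ≠ 0 := by positivity
      field_simp
      ring
    · rw [if_neg (show ¬ m + d + l = m + (l + e) by omega),
        if_neg (show ¬ m + d = m + (l + e - l) by omega),
        if_neg (show ¬ m + d - m + l = l + e by omega),
        if_neg (show ¬ m + d - m = l + e - l by omega),
        if_neg (show ¬ m + d + l = l + e + m by omega)]
      simp
  · rw [if_neg (show ¬ n + l = m + k by omega), if_neg (show ¬ n - m + l = k by omega),
      if_neg (show ¬ n + l = k + m by omega), if_neg hlk]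
    simp
  · rw [if_neg (show ¬ n + l = m + k by omega), if_neg (show ¬ n = m + (k - l) by omega),
      if_neg (show ¬ n + l = k + m by omega), if_neg hmn]
    simp
  · rw [if_neg hmn, if_neg hlk, add_comm m k]
    by_cases h : n + l = k + m
    · rw [if_pos h, if_pos h, if_neg hmn]
      push_cast
      ring
    · rw [if_neg h, if_neg h]
      simp

theorem sum_antidiagonal_hankelGram (n m : ℕ) :
    ∑ p ∈ Finset.HasAntidiagonal.antidiagonal (n + m),
      hankelGram (n, p.2) (p.1, m) * ((p.1 : ℝ) + 1) = m / 2 := by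
  rw [Finset.Nat.sum_antidiagonal_eq_sum_range_succ
    (fun i j => hankelGram (n, j) (i, m) * ((i : ℝ) + 1)) (n + m),
    show (n + m).succ = m + (n + 1) by omega, Finset.sum_range_add]
  have h1 : ∀ k ∈ Finset.range m, hankelGram (n, n + m - k) (k, m) * ((k : ℝ) + 1) =
      ((k : ℝ) + 1) * (1 / (n + m + 1)) := by
    intro k hk
    rw [Finset.mem_range] at hk
    rw [hankelGram, if_neg (by simp only; omega)]
    ring
  have h2 : ∀ k ∈ Finset.range (n + 1),
      hankelGram (n, n + m - (m + k)) (m + k, m) * (((m + k : ℕ) : ℝ) + 1) =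
        ((n : ℝ) - k) * (m / ((n + m + 1) * (n + 1))) := by
    intro k hk
    rw [Finset.mem_range] at hk
    rw [show n + m - (m + k) = n - k by omega, hankelGram, if_pos (by simp only; omega)]
    simp only
    rw [Nat.cast_sub (by omega)]
    push_cast
    have h3 : (m : ℝ) + k + 1 ≠ 0 := by positivity
    field_simp
  rw [Finset.sum_congr rfl h1, Finset.sum_congr rfl h2, ← Finset.sum_mul, ← Finset.sum_mul]
  have h3 : ∀ m : ℕ, ∑ k ∈ Finset.range m, ((k : ℝ) + 1) = m * (m + 1) / 2 := by
    intro m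
    induction m with
    | zero => simp
    | succ m ih => rw [Finset.sum_range_succ, ih]; push_cast; ring
  have h4 : ∀ (x : ℝ) (n : ℕ), ∑ k ∈ Finset.range n, (x - k) = n * x - n * (n - 1) / 2 := by
    intro x n
    induction n with
    | zero => simp
    | succ n ih => rw [Finset.sum_range_succ, ih]; push_cast; ring
  rw [h3, h4]
  push_cast
  field_simp
  ring

theorem sum_hankelGram_le (L K : ℕ) (α β : ℕ → ℝ) :
    ∑ i ∈ Finset.range L ×ˢ Finset.range K, ∑ j ∈ Finset.range L ×ˢ Finset.range K,
      (if i.1 + j.2 = j.1 + i.2 then α i.1 * β i.2 * (α j.1 * β j.2) * hankelGram i j else 0) ≤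
    ∑ n ∈ Finset.range L, ∑ m ∈ Finset.range K, α n ^ 2 * β m ^ 2 * (m / (2 * (n + 1))) := by
  set s := Finset.range L ×ˢ Finset.range K with hs
  set F : ℕ × ℕ → ℕ × ℕ → ℝ := fun i j => if i.1 + j.2 = j.1 + i.2 then
    (α i.1 * β j.2) ^ 2 / (i.1 + 1) * (hankelGram i j * (j.1 + 1)) else 0 with hF
  have hle : ∀ i j : ℕ × ℕ, (if i.1 + j.2 = j.1 + i.2 then
      α i.1 * β i.2 * (α j.1 * β j.2) * hankelGram i j else 0) ≤ (F i j + F j i) / 2 := by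
    intro i j
    simp only [hF]
    by_cases h : i.1 + j.2 = j.1 + i.2
    · rw [if_pos h, if_pos h, if_pos h.symm, ← hankelGram_comm h]
      have hp : (0 : ℝ) < i.1 + 1 := by positivity
      have hq : (0 : ℝ) < j.1 + 1 := by positivity
      have key : α i.1 * β i.2 * (α j.1 * β j.2) ≤
          ((α i.1 * β j.2) ^ 2 / (i.1 + 1) * (j.1 + 1) +
            (α j.1 * β i.2) ^ 2 / (j.1 + 1) * (i.1 + 1)) / 2 := by
        rw [div_mul_eq_mul_div, div_mul_eq_mul_div, div_add_div _ _ hp.ne' hq.ne', div_div,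
          le_div_iff₀ (by positivity)]
        nlinarith [sq_nonneg (α i.1 * β j.2 * (j.1 + 1) - α j.1 * β i.2 * (i.1 + 1))]
      refine (mul_le_mul_of_nonneg_right key (hankelGram_nonneg i j)).trans (le_of_eq ?_)
      ring
    · rw [if_neg h, if_neg h, if_neg (Ne.symm h)]
      simp
  calc _ ≤ ∑ i ∈ s, ∑ j ∈ s, (F i j + F j i) / 2 :=
        Finset.sum_le_sum fun i _ => Finset.sum_le_sum fun j _ => hle i j
    _ = ∑ i ∈ s, ∑ j ∈ s, F i j := by
        simp_rw [add_div, Finset.sum_add_distrib]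
        rw [Finset.sum_comm (f := fun i j => F j i / 2)]
        simp_rw [← Finset.sum_add_distrib, add_halves]
    _ = ∑ n ∈ Finset.range L, ∑ m ∈ Finset.range K, ∑ k ∈ Finset.range L, ∑ l ∈ Finset.range K,
          F (n, l) (k, m) := by
        rw [hs]
        simp_rw [Finset.sum_product]
        refine Finset.sum_congr rfl fun n _ => Finset.sum_comm.trans (Eq.trans ?_ Finset.sum_comm)
        exact Finset.sum_congr rfl fun k _ => Finset.sum_comm
    _ ≤ _ := by
        refine Finset.sum_le_sum fun n _ => Finset.sum_le_sum fun m _ => ?_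
        have h1 : ∀ k l, F (n, l) (k, m) = if n + m = k + l then
            (α n * β m) ^ 2 / (n + 1) * (hankelGram (n, l) (k, m) * (k + 1)) else 0 :=
          fun _ _ => rfl
        simp_rw [h1]
        rw [← Finset.sum_product' (f := fun k l => if n + m = k + l then
            (α n * β m) ^ 2 / (n + 1) * (hankelGram (n, l) (k, m) * (k + 1)) else 0),
          ← Finset.sum_filter, ← Finset.mul_sum]
        have h2 := sum_antidiagonal_hankelGram n m
        have h3 : ∑ p ∈ Finset.range L ×ˢ Finset.range K with n + m = p.1 + p.2,
            hankelGram (n, p.2) (p.1, m) * ((p.1 : ℝ) + 1) ≤ m / 2 := by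
          rw [← h2]
          refine Finset.sum_le_sum_of_subset_of_nonneg (fun p hp => ?_) fun p _ _ =>
            mul_nonneg (hankelGram_nonneg _ _) (by positivity)
          rw [Finset.HasAntidiagonal.mem_antidiagonal]
          exact (Finset.mem_filter.1 hp).2.symm
        refine (mul_le_mul_of_nonneg_left h3 (by positivity)).trans (le_of_eq ?_)
        field_simp

/-- The Hankel operator bound on polynomials. -/
theorem integral_ball_norm_sum_hankelMonomial_sq_le (L K : ℕ) (a b : ℕ → ℂ) :
    ∫ z in ball (0 : ℂ) 1, ‖∑ i ∈ Finset.range L ×ˢ Finset.range K,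
      a i.1 * conj (b i.2) * hankelMonomial i z‖ ^ 2 ≤
    1 / (2 * Real.pi) * ((∑ m ∈ Finset.range K, Real.pi * m * ‖b m‖ ^ 2) *
      ∑ n ∈ Finset.range L, ‖a n‖ ^ 2 * (Real.pi / (n + 1))) := by
  have h := congrArg norm (ofReal_integral_ball_norm_sum_sq (Finset.range L ×ˢ Finset.range K)
    continuous_hankelMonomial (fun i => a i.1 * conj (b i.2)) 1)
  rw [norm_real, Real.norm_of_nonneg (integral_nonneg fun z => by positivity)] at h
  rw [h]
  refine (norm_sum_le_of_le _ fun i _ => norm_sum_le _ _).trans ?_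
  have h1 : ∀ i j : ℕ × ℕ, ‖a i.1 * conj (b i.2) * conj (a j.1 * conj (b j.2)) *
      ∫ z in ball (0 : ℂ) 1, hankelMonomial i z * conj (hankelMonomial j z)‖ =
      Real.pi * (if i.1 + j.2 = j.1 + i.2 then
        ‖a i.1‖ * ‖b i.2‖ * (‖a j.1‖ * ‖b j.2‖) * hankelGram i j else 0) := by
    intro i j
    rw [integral_hankelMonomial_mul_conj]
    split_ifs
    · rw [norm_mul, norm_real, Real.norm_of_nonneg
        (mul_nonneg Real.pi_pos.le (hankelGram_nonneg i j))]
      simp only [norm_mul, RCLike.norm_conj]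
      ring
    · simp
  simp_rw [h1, ← Finset.mul_sum]
  refine (mul_le_mul_of_nonneg_left (sum_hankelGram_le L K (fun n => ‖a n‖) fun n => ‖b n‖)
    Real.pi_pos.le).trans (le_of_eq ?_)
  rw [mul_comm (∑ m ∈ Finset.range K, _), Finset.sum_mul_sum]
  simp_rw [Finset.mul_sum]
  refine Finset.sum_congr rfl fun n _ => Finset.sum_congr rfl fun m _ => ?_
  have := Real.pi_ne_zero
  field_simp

end HankelOnMonomials

section HankelOnDisk

open Filter Metric Set Topology ComplexConjugate

theorem MeasureTheory.eLpNorm_two_le_ofReal {α E : Type*} [MeasurableSpace α]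
    [NormedAddCommGroup E] {μ : Measure α} {u : α → E} {c : ℝ} (hc : 0 ≤ c) :
    eLpNorm u 2 μ ≤ ENNReal.ofReal c ↔ ∫⁻ x, ‖u x‖ₑ ^ 2 ∂μ ≤ ENNReal.ofReal (c ^ 2) := by
  have h := eLpNorm_nnreal_pow_eq_lintegral (f := u) (μ := μ) (p := 2) two_ne_zero
  simp only [NNReal.coe_ofNat, ENNReal.coe_ofNat, ENNReal.rpow_ofNat] at h
  rw [← h, ENNReal.ofReal_pow hc]
  exact (ENNReal.pow_le_pow_left_iff two_ne_zero).symm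

theorem exists_hasSum_of_differentiableOn_ball {f : ℂ → ℂ}
    (hf : DifferentiableOn ℂ f (ball 0 1)) :
    ∃ a : ℕ → ℂ, (∀ z ∈ ball (0 : ℂ) 1, HasSum (fun n => a n * z ^ n) (f z)) ∧
      ∀ z ∈ ball (0 : ℂ) 1, HasSum (fun n => (n + 1) * a (n + 1) * z ^ n) (deriv f z) := by
  refine ⟨fun n => (n.factorial : ℂ)⁻¹ * iteratedDeriv n f 0, fun z hz => ?_, fun z hz => ?_⟩
  · refine (congrArg (HasSum · (f z)) (funext fun n => ?_)).mp
      (Complex.hasSum_taylorSeries_on_ball hf hz)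
    simp only [sub_zero, smul_eq_mul]
    ring
  · refine (congrArg (HasSum · (deriv f z)) (funext fun n => ?_)).mp
      (Complex.hasSum_taylorSeries_on_ball (hf.deriv isOpen_ball) hz)
    simp only [sub_zero, smul_eq_mul, iteratedDeriv_succ', Nat.factorial_succ]
    have h1 : (n : ℂ) + 1 ≠ 0 := by exact_mod_cast n.succ_ne_zero
    have h2 : (n.factorial : ℂ) ≠ 0 := by exact_mod_cast n.factorial_ne_zero
    push_cast
    field_simp

theorem exists_eLpNorm_sub_sum_le {g : ℂ → ℂ} {a : ℕ → ℂ}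
    (hg : ∀ z ∈ ball (0 : ℂ) 1, HasSum (fun n => a n * z ^ n) (g z))
    (hgc : ContinuousOn g (ball 0 1))
    (hgi : IntegrableOn (fun z => ‖g z‖ ^ 2) (ball 0 1)) {ε : ℝ} (hε : 0 < ε) :
    ∃ N, eLpNorm (fun z => g z - ∑ n ∈ Finset.range N, a n * z ^ n) 2
      (volume.restrict (ball 0 1)) ≤ ENNReal.ofReal ε := by
  obtain ⟨N, hN⟩ := exists_setLIntegral_sub_sum_le hg hgc hgi (pow_pos hε 2)
  exact ⟨N, (eLpNorm_two_le_ofReal hε.le).2 hN⟩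

/-- The Hankel operator with symbol `conj ψ` on the unit disk is bounded by the Dirichlet
seminorm of `ψ`. -/
theorem exists_eLpNorm_conj_mul_sub_le_ball {f ψ : ℂ → ℂ} {C ε : ℝ}
    (hf : DifferentiableOn ℂ f (ball 0 1)) (hψ : DifferentiableOn ℂ ψ (ball 0 1))
    (hC : ∀ z ∈ ball (0 : ℂ) 1, ‖ψ z‖ ≤ C)
    (hfi : IntegrableOn (fun z => ‖f z‖ ^ 2) (ball 0 1))
    (hψi : IntegrableOn (fun z => ‖deriv ψ z‖ ^ 2) (ball 0 1)) (hε : 0 < ε) :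
    ∃ G : ℂ → ℂ, DifferentiableOn ℂ G (ball 0 1) ∧
      eLpNorm (fun z => conj (ψ z) * f z - G z) 2 (volume.restrict (ball 0 1)) ≤
        ENNReal.ofReal (√(1 / (2 * Real.pi) * ((∫ z in ball (0 : ℂ) 1, ‖deriv ψ z‖ ^ 2) *
          ∫ z in ball (0 : ℂ) 1, ‖f z‖ ^ 2)) + ε) := by
  obtain ⟨a, ha, -⟩ := exists_hasSum_of_differentiableOn_ball hf
  obtain ⟨b, hb, hb'⟩ := exists_hasSum_of_differentiableOn_ball hψ
  have hC0 : 0 ≤ C := (norm_nonneg _).trans (hC 0 (mem_ball_self one_pos))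
  have hψ2 : IntegrableOn (fun z => ‖ψ z‖ ^ 2) (ball 0 1) := by
    have : IsFiniteMeasure (volume.restrict (ball (0 : ℂ) 1)) :=
      isFiniteMeasure_restrict.2 measure_ball_lt_top.ne
    refine Integrable.of_bound
      (((hψ.continuousOn.norm).pow 2).aestronglyMeasurable measurableSet_ball) (C ^ 2) ?_
    filter_upwards [ae_restrict_mem measurableSet_ball] with z hz
    rw [Real.norm_of_nonneg (by positivity)]
    gcongr
    exact hC z hz
  obtain ⟨L, hL⟩ := exists_eLpNorm_sub_sum_le ha hf.continuousOn hfi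
    (show 0 < ε / (2 * (C + 1)) by positivity)
  set fL : ℂ → ℂ := fun z => ∑ n ∈ Finset.range L, a n * z ^ n with hfL
  set B : ℝ := ∑ n ∈ Finset.range L, ‖a n‖ with hB
  have hB0 : 0 ≤ B := Finset.sum_nonneg fun n _ => norm_nonneg _
  have hfLB : ∀ z ∈ ball (0 : ℂ) 1, ‖fL z‖ ≤ B := by
    intro z hz
    refine norm_sum_le_of_le _ fun n _ => ?_
    rw [norm_mul, norm_pow]
    exact mul_le_of_le_one_right (norm_nonneg _)
      (pow_le_one₀ (norm_nonneg _) (mem_ball_zero_iff.1 hz).le)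
  obtain ⟨K, hK⟩ := exists_eLpNorm_sub_sum_le hb hψ.continuousOn hψ2
    (show 0 < ε / (2 * (B + 1)) by positivity)
  set ψK : ℂ → ℂ := fun z => ∑ m ∈ Finset.range K, b m * z ^ m with hψK
  have hfLc : Continuous fL := by fun_prop
  have hψKc : Continuous ψK := by fun_prop
  set H : ℂ → ℂ := fun z => ∑ i ∈ Finset.range L ×ˢ Finset.range K,
    a i.1 * conj (b i.2) * hankelMonomial i z with hH
  have hHc : Continuous H := continuous_finsetSum _ fun i _ =>
    continuous_const.mul (continuous_hankelMonomial i)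
  set G : ℂ → ℂ := fun z => ∑ i ∈ Finset.range L ×ˢ Finset.range K,
    a i.1 * conj (b i.2) * (bergmanProjCoeff i * z ^ (i.1 - i.2)) with hG
  have hsplit : ∀ z, conj (ψK z) * fL z - G z = H z := by
    intro z
    simp only [hψK, hfL, hG, hH, hankelMonomial, map_sum, mul_sub, Finset.sum_sub_distrib]
    rw [mul_comm, Finset.sum_mul_sum, ← Finset.sum_product']
    congr 1
    refine Finset.sum_congr rfl fun i _ => ?_
    rw [map_mul, map_pow]
    ring
  refine ⟨G, Differentiable.differentiableOn (by fun_prop), ?_⟩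
  have hfun : (fun z => conj (ψ z) * f z - G z) =
      (fun z => conj (ψ z) * (f z - fL z)) + (fun z => conj (ψ z - ψK z) * fL z) + H := by
    funext z
    simp only [Pi.add_apply, ← hsplit, map_sub]
    ring
  have hconj : Continuous (starRingEnd ℂ) := continuous_conj
  have hm1 : AEStronglyMeasurable (fun z => conj (ψ z) * (f z - fL z))
      (volume.restrict (ball 0 1)) :=
    ((hconj.comp_continuousOn hψ.continuousOn).mul
      (hf.continuousOn.sub hfLc.continuousOn)).aestronglyMeasurable measurableSet_ball
  have hm2 : AEStronglyMeasurable (fun z => conj (ψ z - ψK z) * fL z)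
      (volume.restrict (ball 0 1)) :=
    ((hconj.comp_continuousOn (hψ.continuousOn.sub hψKc.continuousOn)).mul
      hfLc.continuousOn).aestronglyMeasurable measurableSet_ball
  have h1 : eLpNorm (fun z => conj (ψ z) * (f z - fL z)) 2 (volume.restrict (ball 0 1)) ≤
      ENNReal.ofReal (ε / 2) := by
    refine (eLpNorm_le_mul_eLpNorm_of_ae_le_mul (g := fun z => f z - fL z) (c := C + 1) ?_ 2).trans
      ((mul_le_mul_right hL _).trans ?_)
    · filter_upwards [ae_restrict_mem measurableSet_ball] with z hz
      rw [norm_mul, RCLike.norm_conj]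
      gcongr
      linarith [hC z hz]
    · rw [← ENNReal.ofReal_mul (by positivity)]
      refine ENNReal.ofReal_le_ofReal (le_of_eq ?_)
      field_simp
  have h2 : eLpNorm (fun z => conj (ψ z - ψK z) * fL z) 2 (volume.restrict (ball 0 1)) ≤
      ENNReal.ofReal (ε / 2) := by
    refine (eLpNorm_le_mul_eLpNorm_of_ae_le_mul (g := fun z => ψ z - ψK z) (c := B + 1) ?_ 2).trans
      ((mul_le_mul_right hK _).trans ?_)
    · filter_upwards [ae_restrict_mem measurableSet_ball] with z hz
      rw [norm_mul, RCLike.norm_conj, mul_comm]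
      gcongr
      linarith [hfLB z hz]
    · rw [← ENNReal.ofReal_mul (by positivity)]
      refine ENNReal.ofReal_le_ofReal (le_of_eq ?_)
      field_simp
  have h3 : eLpNorm H 2 (volume.restrict (ball 0 1)) ≤
      ENNReal.ofReal (√(1 / (2 * Real.pi) * ((∫ z in ball (0 : ℂ) 1, ‖deriv ψ z‖ ^ 2) *
          ∫ z in ball (0 : ℂ) 1, ‖f z‖ ^ 2))) := by
    have hψn : 0 ≤ ∫ z in ball (0 : ℂ) 1, ‖deriv ψ z‖ ^ 2 :=
      integral_nonneg fun z => by positivity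
    have hfn : 0 ≤ ∫ z in ball (0 : ℂ) 1, ‖f z‖ ^ 2 := integral_nonneg fun z => by positivity
    have hHi : IntegrableOn (fun z => ‖H z‖ ^ 2) (ball 0 1) :=
      Continuous.integrableOn_ball (by fun_prop) 1
    have hbessel : ∑ m ∈ Finset.range K, Real.pi * m * ‖b m‖ ^ 2 ≤
        ∫ z in ball (0 : ℂ) 1, ‖deriv ψ z‖ ^ 2 := by
      refine le_trans ?_ (sum_le_integral_ball_norm_sq hb' hψi K)
      refine (Finset.sum_le_sum_of_subset_of_nonneg (Finset.range_mono K.le_succ)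
        fun m _ _ => by positivity).trans (le_of_eq ?_)
      rw [Finset.sum_range_succ']
      simp only [Nat.cast_zero, mul_zero, zero_mul, add_zero]
      refine Finset.sum_congr rfl fun m _ => ?_
      have hm : ‖(m : ℂ) + 1‖ = m + 1 := by
        rw [← Nat.cast_succ, Complex.norm_natCast, Nat.cast_succ]
      rw [norm_mul, hm]
      push_cast
      field_simp
    rw [eLpNorm_two_le_ofReal (Real.sqrt_nonneg _), Real.sq_sqrt (by positivity)]
    have h4 : ∫⁻ z in ball (0 : ℂ) 1, ‖H z‖ₑ ^ 2 =
        ENNReal.ofReal (∫ z in ball (0 : ℂ) 1, ‖H z‖ ^ 2) := by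
      rw [ofReal_integral_eq_lintegral_ofReal hHi (Eventually.of_forall fun z => by positivity)]
      refine lintegral_congr fun z => ?_
      rw [ENNReal.ofReal_pow (norm_nonneg _), ofReal_norm]
    rw [h4]
    refine ENNReal.ofReal_le_ofReal ((integral_ball_norm_sum_hankelMonomial_sq_le L K a b).trans ?_)
    gcongr
    exact sum_le_integral_ball_norm_sq ha hfi L
  rw [hfun]
  have h12 := (eLpNorm_add_le hm1 hm2 one_le_two).trans (add_le_add h1 h2)
  refine (eLpNorm_add_le (hm1.add hm2) hHc.aestronglyMeasurable one_le_two).trans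
    (le_trans (add_le_add h12 h3) (le_of_eq ?_))
  rw [← ENNReal.ofReal_add (by positivity) (by positivity),
    ← ENNReal.ofReal_add (by positivity) (by positivity)]
  congr 1
  ring

end HankelOnDisk

section ConformalInvariance

open Filter Metric Set Topology ComplexConjugate

theorem HasDerivAt.exists_hasFDerivAt_real_det {g : ℂ → ℂ} {g' z : ℂ} (h : HasDerivAt g g' z) :
    ∃ L : ℂ →L[ℝ] ℂ, HasFDerivAt g L z ∧ |L.det| = ‖g'‖ ^ 2 := by
  refine ⟨_, h.hasFDerivAt.restrictScalars ℝ, ?_⟩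
  simp [ContinuousLinearMap.det, LinearMap.det_restrictScalars, Algebra.norm_complex_eq,
    Complex.normSq_eq_norm_sq]

section ChangeOfVariables

variable {s : Set ℂ} {g g' : ℂ → ℂ}

theorem lintegral_image_eq_lintegral_enorm_deriv_sq_mul (hs : MeasurableSet s)
    (hg : ∀ z ∈ s, HasDerivAt g (g' z) z) (hi : InjOn g s) (u : ℂ → ENNReal) :
    ∫⁻ z in g '' s, u z = ∫⁻ z in s, ‖g' z‖ₑ ^ 2 * u (g z) := by
  choose! L hL hd using fun z hz => (hg z hz).exists_hasFDerivAt_real_det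
  rw [lintegral_image_eq_lintegral_abs_det_fderiv_mul volume hs
    (fun z hz => (hL z hz).hasFDerivWithinAt) hi]
  refine setLIntegral_congr_fun hs fun z hz => ?_
  rw [hd z hz, ENNReal.ofReal_pow (norm_nonneg _), ofReal_norm]

theorem integral_image_eq_integral_norm_deriv_sq_mul (hs : MeasurableSet s)
    (hg : ∀ z ∈ s, HasDerivAt g (g' z) z) (hi : InjOn g s) (u : ℂ → ℝ) :
    ∫ z in g '' s, u z = ∫ z in s, ‖g' z‖ ^ 2 * u (g z) := by
  choose! L hL hd using fun z hz => (hg z hz).exists_hasFDerivAt_real_det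
  rw [integral_image_eq_integral_abs_det_fderiv_smul volume hs
    (fun z hz => (hL z hz).hasFDerivWithinAt) hi]
  refine setIntegral_congr_fun hs fun z hz => ?_
  rw [hd z hz, smul_eq_mul]

theorem integrableOn_image_iff_integrableOn_norm_deriv_sq_mul (hs : MeasurableSet s)
    (hg : ∀ z ∈ s, HasDerivAt g (g' z) z) (hi : InjOn g s) (u : ℂ → ℝ) :
    IntegrableOn u (g '' s) ↔ IntegrableOn (fun z => ‖g' z‖ ^ 2 * u (g z)) s := by
  choose! L hL hd using fun z hz => (hg z hz).exists_hasFDerivAt_real_det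
  rw [integrableOn_image_iff_integrableOn_abs_det_fderiv_smul volume hs
    (fun z hz => (hL z hz).hasFDerivWithinAt) hi]
  refine integrableOn_congr_fun (fun z hz => ?_) hs
  rw [hd z hz, smul_eq_mul]

end ChangeOfVariables

/-- The Hankel operator with symbol `conj ψ` on a bounded simply connected open set is bounded by
the Dirichlet seminorm of `ψ`. -/
theorem exists_eLpNorm_conj_mul_sub_le {Ω : Set ℂ} (hΩo : IsOpen Ω)
    (hΩb : Bornology.IsBounded Ω) (hΩc : IsSimplyConnected Ω) {f ψ : ℂ → ℂ} {C ε : ℝ}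
    (hf : DifferentiableOn ℂ f Ω) (hψ : DifferentiableOn ℂ ψ Ω) (hC : ∀ z ∈ Ω, ‖ψ z‖ ≤ C)
    (hfi : IntegrableOn (fun z => ‖f z‖ ^ 2) Ω)
    (hψi : IntegrableOn (fun z => ‖deriv ψ z‖ ^ 2) Ω) (hε : 0 < ε) :
    ∃ G : ℂ → ℂ, DifferentiableOn ℂ G Ω ∧
      eLpNorm (fun z => conj (ψ z) * f z - G z) 2 (volume.restrict Ω) ≤
        ENNReal.ofReal (√(1 / (2 * Real.pi) * ((∫ z in Ω, ‖deriv ψ z‖ ^ 2) *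
          ∫ z in Ω, ‖f z‖ ^ 2)) + ε) := by
  obtain ⟨φ, hφ, hφs⟩ := IsDiskEmbedding.exists_surjOn hΩo hΩb hΩc
  obtain ⟨χ, hχm, hφχ, hχφ, hχ⟩ := hφ.exists_inverse hΩo hφs
  have hφd : DifferentiableOn ℂ φ Ω := hφ.differentiableOn
  set χ' : ℂ → ℂ := fun w => (deriv φ (χ w))⁻¹ with hχ'
  have hinj : InjOn χ (ball 0 1) := fun w hw w' hw' h => by rw [← hφχ w hw, h, hφχ w' hw']
  have himage : χ '' ball 0 1 = Ω :=
    Subset.antisymm hχm.image_subset fun z hz => ⟨φ z, hφ.mapsTo hz, hχφ z hz⟩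
  have hχd : DifferentiableOn ℂ χ (ball 0 1) := fun w hw =>
    (hχ w hw).differentiableAt.differentiableWithinAt
  have hχ'd : DifferentiableOn ℂ χ' (ball 0 1) :=
    ((hφd.deriv hΩo).comp hχd hχm).inv fun w hw => hφ.deriv_ne_zero _ (hχm hw)
  have hψχ : ∀ w ∈ ball (0 : ℂ) 1, deriv (ψ ∘ χ) w = deriv ψ (χ w) * χ' w := fun w hw =>
    ((hψ.differentiableAt (hΩo.mem_nhds (hχm hw))).hasDerivAt.comp w (hχ w hw)).deriv
  have hfeq : ∀ w, ‖χ' w‖ ^ 2 * ‖f (χ w)‖ ^ 2 = ‖f (χ w) * χ' w‖ ^ 2 := fun w => by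
    rw [norm_mul]; ring
  have hψeq : ∀ w ∈ ball (0 : ℂ) 1,
      ‖χ' w‖ ^ 2 * ‖deriv ψ (χ w)‖ ^ 2 = ‖deriv (ψ ∘ χ) w‖ ^ 2 := fun w hw => by
    rw [hψχ w hw, norm_mul]; ring
  have hfint : ∫ z in Ω, ‖f z‖ ^ 2 = ∫ w in ball (0 : ℂ) 1, ‖f (χ w) * χ' w‖ ^ 2 := by
    rw [← himage, integral_image_eq_integral_norm_deriv_sq_mul measurableSet_ball hχ hinj]
    exact setIntegral_congr_fun measurableSet_ball fun w _ => hfeq w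
  have hψint : ∫ z in Ω, ‖deriv ψ z‖ ^ 2 = ∫ w in ball (0 : ℂ) 1, ‖deriv (ψ ∘ χ) w‖ ^ 2 := by
    rw [← himage, integral_image_eq_integral_norm_deriv_sq_mul measurableSet_ball hχ hinj]
    exact setIntegral_congr_fun measurableSet_ball hψeq
  rw [← himage, integrableOn_image_iff_integrableOn_norm_deriv_sq_mul measurableSet_ball hχ hinj,
    integrableOn_congr_fun (fun w _ => hfeq w) measurableSet_ball] at hfi
  rw [← himage, integrableOn_image_iff_integrableOn_norm_deriv_sq_mul measurableSet_ball hχ hinj,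
    integrableOn_congr_fun hψeq measurableSet_ball] at hψi
  obtain ⟨G, hG, hGle⟩ := exists_eLpNorm_conj_mul_sub_le_ball ((hf.comp hχd hχm).mul hχ'd)
    (hψ.comp hχd hχm) (fun w hw => hC _ (hχm hw)) hfi hψi hε
  refine ⟨fun z => G (φ z) * deriv φ z, (hG.comp hφd hφ.mapsTo).mul (hφd.deriv hΩo), ?_⟩
  rw [hfint, hψint]
  rw [eLpNorm_two_le_ofReal (by positivity)] at hGle ⊢
  refine le_trans (le_of_eq ?_) hGle
  rw [← himage, lintegral_image_eq_lintegral_enorm_deriv_sq_mul measurableSet_ball hχ hinj]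
  refine setLIntegral_congr_fun measurableSet_ball fun w hw => ?_
  have h0 : deriv φ (χ w) ≠ 0 := hφ.deriv_ne_zero _ (hχm hw)
  simp only [Function.comp_apply, Pi.mul_apply]
  rw [hφχ w hw, ← mul_pow, ← enorm_mul]
  congr 2
  simp only [hχ']
  field_simp

end ConformalInvariance

section Commutator

open scoped InnerProductSpace

theorem ContinuousLinearMap.norm_commutator_le_of_norm_sub_le {E : Type*} [NormedAddCommGroup E]
    [InnerProductSpace ℂ E] [CompleteSpace E] {A : Submodule ℂ E} [CompleteSpace A] {c : ℝ}
    (hc : 0 ≤ c) {P M : E →L[ℂ] E} (hPmem : ∀ u, P u ∈ A) (hPfix : ∀ u ∈ A, P u = u)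
    (hPorth : ∀ u, u - P u ∈ Aᗮ) (hMA : ∀ u ∈ A, M u ∈ A)
    (hMnormal : ∀ u v, ⟪M u, M v⟫_ℂ = ⟪adjoint M u, adjoint M v⟫_ℂ) {T : A →L[ℂ] A}
    (hT : ∀ h : A, (T h : E) = P (M h))
    (hbound : ∀ u ∈ A, ‖adjoint M u - P (adjoint M u)‖ ≤ √c * ‖u‖) :
    ‖adjoint T ∘L T - T ∘L adjoint T‖ ≤ c := by
  set H : A →L[ℂ] E := (ContinuousLinearMap.id ℂ E - P) ∘L adjoint M ∘L A.subtypeL with hH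
  have hHapply : ∀ h : A, H h = adjoint M h - P (adjoint M h) := fun h => rfl
  have hTM : ∀ h : A, (T h : E) = M h := fun h => by rw [hT, hPfix _ (hMA _ h.2)]
  have hort : ∀ u, ∀ v ∈ A, ⟪v, u - P u⟫_ℂ = 0 := fun u v hv =>
    (Submodule.mem_orthogonal A _).1 (hPorth u) v hv
  have hort' : ∀ u, ∀ v ∈ A, ⟪u - P u, v⟫_ℂ = 0 := fun u v hv =>
    (Submodule.mem_orthogonal' A _).1 (hPorth u) v hv
  have hTadj : ∀ h : A, (adjoint T h : E) = P (adjoint M h) := by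
    intro h
    have : adjoint T h = ⟨P (adjoint M h), hPmem _⟩ := by
      refine ext_inner_right ℂ fun k => ?_
      rw [adjoint_inner_left, Submodule.coe_inner, hTM, Submodule.coe_inner,
        ← adjoint_inner_left, ← sub_eq_zero, ← inner_sub_left]
      exact hort' _ _ k.2
    rw [this]
  have key : adjoint T ∘L T - T ∘L adjoint T = adjoint H ∘L H := by
    ext1 h
    refine ext_inner_right ℂ fun k => ?_
    have h1 : ⟪adjoint T (T h), k⟫_ℂ = ⟪T h, T k⟫_ℂ := adjoint_inner_left T _ _
    have h2 : ⟪T (adjoint T h), k⟫_ℂ = ⟪adjoint T h, adjoint T k⟫_ℂ :=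
      (adjoint_inner_right T _ _).symm
    have h3 : ⟪adjoint H (H h), k⟫_ℂ = ⟪H h, H k⟫_ℂ := adjoint_inner_left H _ _
    rw [sub_apply, comp_apply, comp_apply, comp_apply, inner_sub_left, h1, h2, h3,
      Submodule.coe_inner, Submodule.coe_inner, hTM, hTM, hMnormal, hTadj, hTadj, hHapply, hHapply,
      inner_sub_right, hort' _ _ (hPmem _), sub_zero, inner_sub_left]
    congr 1
    rw [← sub_eq_zero, ← inner_sub_right, ← neg_sub, inner_neg_right, hort _ _ (hPmem _), neg_zero]
  have hHn : ‖H‖ ≤ √c := H.opNorm_le_bound (Real.sqrt_nonneg c) fun h => hbound h h.2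
  rw [key, norm_adjoint_comp_self, ← Real.mul_self_sqrt hc]
  gcongr

theorem norm_sub_le_norm_sub_of_mem {E : Type*} [NormedAddCommGroup E]
    [InnerProductSpace ℂ E] {A : Submodule ℂ E} {P : E → E} (hPmem : ∀ u, P u ∈ A)
    (hPorth : ∀ u, u - P u ∈ Aᗮ) (u : E) {v : E} (hv : v ∈ A) : ‖u - P u‖ ≤ ‖u - v‖ := by
  have h0 : ⟪u - P u, P u - v⟫_ℂ = 0 :=
    (Submodule.mem_orthogonal' A _).1 (hPorth u) _ (A.sub_mem (hPmem u) hv)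
  have h := norm_add_sq_eq_norm_sq_add_norm_sq_of_inner_eq_zero _ _ h0
  rw [sub_add_sub_cancel] at h
  nlinarith [norm_nonneg (u - P u), norm_nonneg (u - v), mul_self_nonneg ‖P u - v‖]

end Commutator

section MultiplicationOperator

open ComplexConjugate
open scoped InnerProductSpace

variable {α : Type*} [MeasurableSpace α] {μ : Measure α} {ψ : α → ℂ}
  {M : Lp ℂ 2 μ →L[ℂ] Lp ℂ 2 μ}

theorem adjoint_mul_ae_eq_conj_mul {C : ℝ} (hψ : AEStronglyMeasurable ψ μ)
    (hC : ∀ᵐ x ∂μ, ‖ψ x‖ ≤ C) (hM : ∀ u, M u =ᵐ[μ] fun x => ψ x * u x) (u : Lp ℂ 2 μ) :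
    adjoint M u =ᵐ[μ] fun x => conj (ψ x) * u x := by
  have hw : MemLp (fun x => conj (ψ x) * u x) 2 μ := by
    refine MemLp.of_le_mul (c := C) (Lp.memLp u)
      ((continuous_conj.comp_aestronglyMeasurable hψ).mul (Lp.aestronglyMeasurable u)) ?_
    filter_upwards [hC] with x hx
    rw [norm_mul, RCLike.norm_conj]
    gcongr
  have h : adjoint M u = hw.toLp _ := by
    refine ext_inner_right ℂ fun v => ?_
    rw [adjoint_inner_left, L2.inner_def, L2.inner_def]
    refine integral_congr_ae ?_
    filter_upwards [hM v, hw.coeFn_toLp] with x h1 h2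
    rw [h1, h2, RCLike.inner_apply, RCLike.inner_apply, map_mul, conj_conj]
    ring
  rw [h]
  exact hw.coeFn_toLp

theorem inner_mul_eq_inner_adjoint_mul {C : ℝ} (hψ : AEStronglyMeasurable ψ μ)
    (hC : ∀ᵐ x ∂μ, ‖ψ x‖ ≤ C) (hM : ∀ u, M u =ᵐ[μ] fun x => ψ x * u x) (u v : Lp ℂ 2 μ) :
    ⟪M u, M v⟫_ℂ = ⟪adjoint M u, adjoint M v⟫_ℂ := by
  rw [L2.inner_def, L2.inner_def]
  refine integral_congr_ae ?_
  filter_upwards [hM u, hM v, adjoint_mul_ae_eq_conj_mul hψ hC hM u,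
    adjoint_mul_ae_eq_conj_mul hψ hC hM v] with x h1 h2 h3 h4
  rw [h1, h2, h3, h4]
  simp only [RCLike.inner_apply, map_mul, conj_conj]
  ring

theorem integral_norm_sq_eq_norm_sq (u : Lp ℂ 2 μ) : ∫ x, ‖u x‖ ^ 2 ∂μ = ‖u‖ ^ 2 := by
  apply ofReal_injective
  have h := inner_self_eq_norm_sq_to_K (𝕜 := ℂ) u
  rw [L2.inner_def] at h
  simp only [inner_self_eq_norm_sq_to_K] at h
  rw [← integral_complex_ofReal]
  push_cast
  exact h

end MultiplicationOperator

/-- Putnam-type inequality for Toeplitz operators with bounded analytic symbol on the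
Bergman space `A²(Ω)` of a bounded simply connected domain:
`‖T_ψ* T_ψ - T_ψ T_ψ*‖ ≤ (1/(2π)) ∫_Ω |ψ'|²`.  Here `A` is the Bergman space regarded
as a closed subspace of `L²(Ω)`, `P` is the orthogonal projection onto `A`, `M` is
multiplication by `ψ`, and `T` is the Toeplitz operator `T h = P (ψ h)`. -/
theorem putnam_type_toeplitz_bergman
    (Ω : Set ℂ) (hΩo : IsOpen Ω) (hΩne : Ω.Nonempty) (hΩb : Bornology.IsBounded Ω)
    (hΩsc : SimplyConnectedSpace Ω)
    (ψ : ℂ → ℂ) (hψ : DifferentiableOn ℂ ψ Ω) (hψb : ∃ C : ℝ, ∀ z ∈ Ω, ‖ψ z‖ ≤ C)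
    (hψ'2 : IntegrableOn (fun z => ‖deriv ψ z‖ ^ 2) Ω volume)
    (A : Submodule ℂ (Lp ℂ 2 (volume.restrict Ω)))
    (hA : ∀ u : Lp ℂ 2 (volume.restrict Ω), u ∈ A ↔
      ∃ g : ℂ → ℂ, DifferentiableOn ℂ g Ω ∧ u =ᵐ[volume.restrict Ω] g)
    (hAclosed : IsClosed (A : Set (Lp ℂ 2 (volume.restrict Ω))))
    [CompleteSpace A]
    (P : Lp ℂ 2 (volume.restrict Ω) →L[ℂ] Lp ℂ 2 (volume.restrict Ω))
    (hPmem : ∀ u, P u ∈ A) (hPfix : ∀ u ∈ A, P u = u)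
    (hPorth : ∀ u, u - P u ∈ Aᗮ)
    (M : Lp ℂ 2 (volume.restrict Ω) →L[ℂ] Lp ℂ 2 (volume.restrict Ω))
    (hM : ∀ u : Lp ℂ 2 (volume.restrict Ω),
      (M u : ℂ → ℂ) =ᵐ[volume.restrict Ω] fun z => ψ z * u z)
    (T : A →L[ℂ] A)
    (hT : ∀ h : A, (T h : Lp ℂ 2 (volume.restrict Ω)) = P (M h)) :
    ‖adjoint T ∘L T - T ∘L adjoint T‖ ≤
      (1 / (2 * Real.pi)) * ∫ z in Ω, ‖deriv ψ z‖ ^ 2 := by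
  obtain ⟨C, hC⟩ := hψb
  have hψm : AEStronglyMeasurable ψ (volume.restrict Ω) :=
    hψ.continuousOn.aestronglyMeasurable hΩo.measurableSet
  have hCae : ∀ᵐ z ∂volume.restrict Ω, ‖ψ z‖ ≤ C := by
    filter_upwards [ae_restrict_mem hΩo.measurableSet] with z hz using hC z hz
  have hD : 0 ≤ ∫ z in Ω, ‖deriv ψ z‖ ^ 2 := integral_nonneg fun z => by positivity
  refine norm_commutator_le_of_norm_sub_le (by positivity) hPmem hPfix hPorth (fun u hu => ?_)
    (inner_mul_eq_inner_adjoint_mul hψm hCae hM) hT fun u hu => ?_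
  · obtain ⟨f, hf, huf⟩ := (hA u).1 hu
    refine (hA _).2 ⟨fun z => ψ z * f z, hψ.mul hf, ?_⟩
    filter_upwards [hM u, huf] with z h1 h2
    rw [h1, h2]
  · obtain ⟨f, hf, huf⟩ := (hA u).1 hu
    have hfi : IntegrableOn (fun z => ‖f z‖ ^ 2) Ω := by
      refine (Lp.memLp u).integrable_norm_pow two_ne_zero |>.congr ?_
      filter_upwards [huf] with z hz
      rw [hz]
    have hfn : ∫ z in Ω, ‖f z‖ ^ 2 = ‖u‖ ^ 2 := by
      rw [← integral_norm_sq_eq_norm_sq]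
      refine integral_congr_ae ?_
      filter_upwards [huf] with z hz
      rw [hz]
    refine le_of_forall_pos_le_add fun ε hε => ?_
    obtain ⟨G, hG, hGle⟩ := exists_eLpNorm_conj_mul_sub_le hΩo hΩb hΩsc hf hψ hC hfi hψ'2 hε
    rw [hfn, ← mul_assoc, Real.sqrt_mul (by positivity), Real.sqrt_sq (norm_nonneg u)] at hGle
    have hN : adjoint M u =ᵐ[volume.restrict Ω] fun z => starRingEnd ℂ (ψ z) * f z := by
      filter_upwards [adjoint_mul_ae_eq_conj_mul hψm hCae hM u, huf] with z h1 h2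
      rw [h1, h2]
    have hGm : MemLp G 2 (volume.restrict Ω) := by
      have h1 : MemLp (fun z => starRingEnd ℂ (ψ z) * f z) 2 (volume.restrict Ω) :=
        (memLp_congr_ae hN).1 (Lp.memLp _)
      have h2 : MemLp (fun z => starRingEnd ℂ (ψ z) * f z - G z) 2 (volume.restrict Ω) :=
        ⟨h1.1.sub (hG.continuousOn.aestronglyMeasurable hΩo.measurableSet),
          hGle.trans_lt ENNReal.ofReal_lt_top⟩
      have h3 := h1.sub h2
      refine (memLp_congr_ae (Filter.Eventually.of_forall fun z => ?_)).1 h3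
      simp
    have hGA : hGm.toLp G ∈ A := (hA _).2 ⟨G, hG, hGm.coeFn_toLp⟩
    refine (norm_sub_le_norm_sub_of_mem hPmem hPorth _ hGA).trans ?_
    rw [Lp.norm_def]
    refine ENNReal.toReal_le_of_le_ofReal (by positivity) (le_trans (le_of_eq ?_) hGle)
    refine eLpNorm_congr_ae ?_
    filter_upwards [Lp.coeFn_sub (adjoint M u) (hGm.toLp G), hN, hGm.coeFn_toLp] with z h1 h2 h3
    rw [h1, Pi.sub_apply, h2, h3]
end

section
/- Let α > −1 be real, let Ω ⊂ ℂ be a nonempty bounded simply connected open set, let φ : Ω → 𝔻 be a biholomorphic map onto the unit disc, and set w_α(z) = (1+α)(1−|φ(z)|²)^α / |φ'(z)|^α for z ∈ Ω. Let ψ be a bounded holomorphic function on Ω with ∫_Ω |ψ'(z)|² dxdy < ∞, and let f be holomorphic on Ω with ∫_Ω |f(z)|² w_α(z) dxdy < ∞. Then the infimum, over all holomorphic functions g on Ω with ∫_Ω |g|² w_α dxdy < ∞, of ∫_Ω |conj(ψ(z))·f(z) − g(z)|² w_α(z) dxdy is at most (1/((2+α)π)) · (∫_Ω |ψ'(z)|²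 dxdy) · (∫_Ω |f(z)|² w_α(z) dxdy). (This is the Putnam-type corollary on weighted Bergman spaces A²_α(Ω): ‖H_{conj ψ}‖²_{A²_α(Ω)→L²_α(Ω)} ≤ ‖ψ'‖²_{A²(Ω)}/(2+α).) -/
open MeasureTheory Complex
open scoped ENNReal

/-- `h` is the sequence of Taylor coefficients of `H` on the unit disc. -/
def HasDiscSeries (H : ℂ → ℂ) (h : ℕ → ℂ) : Prop :=
  ∀ z ∈ Metric.ball (0 : ℂ) 1, HasSum (fun n => h n * z ^ n) (H z)

/-- Half of the normalised squared norm of `z ^ n` for the weight `(1 - |z|²) ^ α`. -/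
noncomputable def radialMoment (α : ℝ) (n : ℕ) : ℝ :=
  ∫ r in (0 : ℝ)..1, r ^ (2 * n + 1) * (1 - r ^ 2) ^ α

lemma HasDiscSeries.summable_norm {H : ℂ → ℂ} {h : ℕ → ℂ} (hH : HasDiscSeries H h) {z : ℂ}
    (hz : z ∈ Metric.ball (0 : ℂ) 1) : Summable (fun n => ‖h n * z ^ n‖) :=
  (hH z hz).summable.norm

lemma integral_cexp_intCast_mul_I (k : ℤ) :
    ∫ θ in (-Real.pi)..Real.pi, cexp (k * θ * I) = if k = 0 then 2 * Real.pi else 0 := by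
  split_ifs with hk
  · subst hk
    simp
    ring
  · have hk' : (k * I : ℂ) ≠ 0 := by simp [hk]
    have h : ∀ θ : ℝ, cexp (k * θ * I) = cexp ((k * I) * θ) := fun θ => by ring_nf
    simp_rw [h]
    rw [integral_exp_mul_complex hk']
    have : cexp (k * I * (Real.pi : ℝ)) = cexp (k * I * ((-Real.pi : ℝ) : ℂ)) := by
      rw [Complex.exp_eq_exp_iff_exists_int]
      exact ⟨k, by push_cast; ring⟩
    rw [this]; simp

lemma HasDiscSeries.hasSum_circle {H : ℂ → ℂ} {h : ℕ → ℂ} (hH : HasDiscSeries H h) {r : ℝ}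
    (hr0 : 0 ≤ r) (hr1 : r < 1) :
    HasSum (fun n => 2 * Real.pi * (‖h n‖ ^ 2 * r ^ (2 * n)))
      (∫ θ in (-Real.pi)..Real.pi, ‖H (r * cexp (θ * I))‖ ^ 2) := by
  have hmem : ∀ θ : ℝ, (r * cexp (θ * I) : ℂ) ∈ Metric.ball (0 : ℂ) 1 := fun θ => by
    simp [abs_of_nonneg hr0, hr1]
  have hS : Summable (fun n => ‖h n‖ * r ^ n) := by
    have := hH.summable_norm (hmem 0)
    simpa [abs_of_nonneg hr0] using this
  set F : ℕ × ℕ → C(ℝ, ℂ) := fun p =>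
    ⟨fun θ => (h p.1 * (r * cexp (θ * I)) ^ p.1) *
      (starRingEnd ℂ) (h p.2 * (r * cexp (θ * I)) ^ p.2), by
        have := Complex.continuous_conj; fun_prop⟩ with hF
  have hnorm : ∀ p θ, ‖F p θ‖ = (‖h p.1‖ * r ^ p.1) * (‖h p.2‖ * r ^ p.2) := fun p θ => by
    simp [hF, abs_of_nonneg hr0]
  have hFs : Summable (fun p : ℕ × ℕ => (‖h p.1‖ * r ^ p.1) * (‖h p.2‖ * r ^ p.2)) :=
    hS.mul_of_nonneg hS (fun n => by positivity) (fun n => by positivity)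
  have key := intervalIntegral.hasSum_intervalIntegral_of_summable_norm
    (a := -Real.pi) (b := Real.pi)
    (f := F) (by
      refine Summable.of_nonneg_of_le (fun _ => norm_nonneg _) (fun p => ?_) hFs
      rw [ContinuousMap.norm_le _ (by positivity)]
      intro x
      exact (hnorm p x).le)
  have hsum : ∀ θ : ℝ, ∑' p, F p θ = ((‖H (r * cexp (θ * I))‖ ^ 2 : ℝ) : ℂ) := fun θ => by
    have h1 := hH _ (hmem θ)
    have h2 : HasSum (fun n => (starRingEnd ℂ) (h n * (r * cexp (θ * I)) ^ n))
      ((starRingEnd ℂ) (H (r * cexp (θ * I)))) := Complex.hasSum_conj'.2 (by simpa using h1)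
    have h3 := h1.mul h2 (by
      have := hFs
      refine Summable.of_norm ?_
      convert! this using 2 with p
      exact hnorm p θ)
    have h4 := h3.tsum_eq
    rw [Complex.mul_conj, Complex.normSq_eq_norm_sq] at h4
    exact h4
  simp_rw [hsum, intervalIntegral.integral_ofReal] at key
  have hint : ∀ p : ℕ × ℕ, ∫ θ in (-Real.pi)..Real.pi, F p θ =
      if p.1 = p.2 then ((2 * Real.pi * (‖h p.1‖ ^ 2 * r ^ (2 * p.1)) : ℝ) : ℂ) else 0 := by
    rintro ⟨n, m⟩
    have : ∀ θ : ℝ, F (n, m) θ = (h n * (starRingEnd ℂ) (h m) * r ^ (n + m)) *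
        cexp (((n - m : ℤ) : ℂ) * θ * I) := fun θ => by
      simp only [hF, ContinuousMap.coe_mk, map_mul, map_pow, map_natCast, Complex.conj_ofReal,
        ← Complex.exp_conj,
        Complex.conj_I, mul_pow, ← Complex.exp_nat_mul]
      have : cexp (((n - m : ℤ) : ℂ) * θ * I) = cexp (n * (θ * I)) * cexp (m * (θ * -I)) := by
        rw [← Complex.exp_add]; push_cast; ring_nf
      rw [this, pow_add]; ring
    simp_rw [this]
    rw [intervalIntegral.integral_const_mul, integral_cexp_intCast_mul_I]
    by_cases hnm : n = m
    · subst hnm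
      simp only [sub_self, if_true]
      rw [Complex.mul_conj, Complex.normSq_eq_norm_sq]
      push_cast; ring
    · have : (n - m : ℤ) ≠ 0 := by omega
      simp [hnm, this]
  simp_rw [hint] at key
  have hinj : Function.Injective (fun n : ℕ => (n, n)) := fun a b hab => by simpa using hab
  rw [← hinj.hasSum_iff] at key
  · simp only [Function.comp_def, if_true] at key
    exact_mod_cast key
  · rintro ⟨n, m⟩ hp
    have : n ≠ m := fun h => hp ⟨n, by simp [h]⟩
    simp [this]

lemma hasDerivAt_one_sub_sq_rpow {r : ℝ} (hr : r ∈ Set.Ioo (0 : ℝ) 1) (β : ℝ) :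
    HasDerivAt (fun r : ℝ => (1 - r ^ 2) ^ β) (-(2 * r) * β * (1 - r ^ 2) ^ (β - 1)) r := by
  have h1 : HasDerivAt (fun r : ℝ => 1 - r ^ 2) (-(2 * r)) r := by
    simpa using (hasDerivAt_pow 2 r).const_sub 1
  exact h1.rpow_const (Or.inl (by nlinarith [hr.1, hr.2]))

lemma continuousOn_one_sub_sq_rpow {β : ℝ} (hβ : 0 ≤ β) (s : Set ℝ) :
    ContinuousOn (fun r : ℝ => (1 - r ^ 2) ^ β) s :=
  ContinuousOn.rpow_const (by fun_prop) (fun _ _ => Or.inr hβ)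

lemma intervalIntegrable_radial {α : ℝ} (hα : -1 < α) (n : ℕ) :
    IntervalIntegrable (fun r : ℝ => r ^ (2 * n + 1) * (1 - r ^ 2) ^ α) volume 0 1 := by
  have h0 : IntervalIntegrable (fun r : ℝ => r * (1 - r ^ 2) ^ α) volume 0 1 := by
    rw [intervalIntegrable_iff_integrableOn_Ioc_of_le zero_le_one]
    have hne : α + 1 ≠ 0 := by linarith
    refine intervalIntegral.integrableOn_deriv_of_nonneg
      (g := fun r : ℝ => -(1 / (2 * (α + 1))) * (1 - r ^ 2) ^ (α + 1)) ?_ (fun r hr => ?_)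
      (fun r hr => ?_)
    · exact continuousOn_const.mul (continuousOn_one_sub_sq_rpow (by linarith) _)
    · convert! (hasDerivAt_one_sub_sq_rpow hr (α + 1)).const_mul (-(1 / (2 * (α + 1)))) using 1
      rw [add_sub_cancel_right]
      field_simp
    · have : 0 ≤ 1 - r ^ 2 := by nlinarith [hr.1, hr.2]
      have := Real.rpow_nonneg this α
      exact mul_nonneg hr.1.le this
  have h1 := h0.continuousOn_mul (g := fun r : ℝ => r ^ (2 * n)) (by fun_prop)
  refine h1.congr (fun r _ => ?_)
  ring

lemma radialMoment_succ {α : ℝ} (hα : -1 < α) (n : ℕ) :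
    (n + 2 + α) * radialMoment α (n + 1) = (n + 1) * radialMoment α n := by
  have hi := ((intervalIntegrable_radial hα n).const_mul (2 * (n + 1))).sub
    ((intervalIntegrable_radial hα (n + 1)).const_mul (2 * (n + 2 + α)))
  have key := intervalIntegral.integral_eq_sub_of_hasDerivAt_of_le (zero_le_one (α := ℝ))
    (f := fun r : ℝ => r ^ (2 * n + 2) * (1 - r ^ 2) ^ (α + 1))
    (f' := fun r => 2 * (n + 1) * (r ^ (2 * n + 1) * (1 - r ^ 2) ^ α) -
      2 * (n + 2 + α) * (r ^ (2 * (n + 1) + 1) * (1 - r ^ 2) ^ α))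
    ((by fun_prop : ContinuousOn (fun r : ℝ => r ^ (2 * n + 2)) _).mul
      (continuousOn_one_sub_sq_rpow (by linarith) _))
    (fun r hr => by
      convert! (hasDerivAt_pow (2 * n + 2) r).mul (hasDerivAt_one_sub_sq_rpow hr (α + 1)) using 1
      have hpos : 0 < 1 - r ^ 2 := by nlinarith [hr.1, hr.2]
      rw [add_sub_cancel_right, Real.rpow_add_one hpos.ne']
      push_cast
      ring) hi
  rw [intervalIntegral.integral_sub ((intervalIntegrable_radial hα n).const_mul _)
    ((intervalIntegrable_radial hα (n + 1)).const_mul _), intervalIntegral.integral_const_mul,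
    intervalIntegral.integral_const_mul] at key
  have h1 : ((1 : ℝ) - 1 ^ 2) ^ (α + 1) = 0 := by
    rw [one_pow, sub_self, Real.zero_rpow (by linarith)]
  rw [h1] at key
  simp only [mul_zero, zero_pow (by omega : 2 * n + 2 ≠ 0), zero_mul, sub_zero] at key
  unfold radialMoment
  linarith

lemma radialMoment_pos {α : ℝ} (hα : -1 < α) (n : ℕ) : 0 < radialMoment α n := by
  refine intervalIntegral.intervalIntegral_pos_of_pos_on (intervalIntegrable_radial hα n)
    (fun r hr => ?_) one_pos
  have h1 : 0 < 1 - r ^ 2 := by nlinarith [hr.1, hr.2]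
  have := Real.rpow_pos_of_pos h1 α
  have := hr.1
  positivity

lemma radialMoment_zero_left (n : ℕ) : radialMoment 0 n = 1 / (2 * (n + 1)) := by
  have h : (2 : ℝ) * n + 1 + 1 ≠ 0 := by positivity
  unfold radialMoment
  simp only [Real.rpow_zero, mul_one, integral_pow]
  push_cast
  simp
  field_simp
  ring

lemma HasDiscSeries.lintegral_radial {H : ℂ → ℂ} {h : ℕ → ℂ} (hH : HasDiscSeries H h)
    (hc : ContinuousOn H (Metric.ball 0 1)) {α : ℝ} (hα : -1 < α) :
    ∫⁻ z in Metric.ball (0 : ℂ) 1, ENNReal.ofReal (‖H z‖ ^ 2 * (1 - ‖z‖ ^ 2) ^ α) =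
      ∑' n, ENNReal.ofReal (2 * Real.pi * (‖h n‖ ^ 2 * radialMoment α n)) := by
  classical
  set K : ℂ → ℂ := (Metric.ball (0 : ℂ) 1).piecewise H 0 with hK
  have hKm : Measurable K :=
    hc.measurable_piecewise continuousOn_const Metric.isOpen_ball.measurableSet
  set g : ℂ → ℝ≥0∞ := (Metric.ball (0 : ℂ) 1).indicator
    (fun z => ENNReal.ofReal (‖K z‖ ^ 2 * (1 - ‖z‖ ^ 2) ^ α)) with hg
  have hgm : Measurable g := by
    refine Measurable.indicator ?_ Metric.isOpen_ball.measurableSet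
    fun_prop
  have e1 : ∫⁻ z in Metric.ball (0 : ℂ) 1, ENNReal.ofReal (‖H z‖ ^ 2 * (1 - ‖z‖ ^ 2) ^ α) =
      ∫⁻ z, g z := by
    rw [hg, lintegral_indicator Metric.isOpen_ball.measurableSet]
    refine setLIntegral_congr_fun Metric.isOpen_ball.measurableSet (fun z hz => ?_)
    simp only [hK, Set.piecewise_eq_of_mem _ _ _ hz]
  have hsymm : ∀ p : ℝ × ℝ, Complex.polarCoord.symm p = p.1 * cexp (p.2 * I) := fun p => by
    rw [Complex.polarCoord_symm_apply, Complex.exp_mul_I]; push_cast; rfl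
  have hpm : Measurable (fun p : ℝ × ℝ => ENNReal.ofReal p.1 • g (Complex.polarCoord.symm p)) := by
    simp_rw [hsymm]
    have : Measurable (fun p : ℝ × ℝ => (p.1 * cexp (p.2 * I) : ℂ)) := by fun_prop
    exact (by fun_prop : Measurable fun p : ℝ × ℝ => ENNReal.ofReal p.1).smul (hgm.comp this)
  rw [e1, ← Complex.lintegral_comp_polarCoord_symm, polarCoord_target,
    Measure.volume_eq_prod, ← Measure.prod_restrict, lintegral_prod _ hpm.aemeasurable]
  have e2 : ∀ r ∈ Set.Ioi (0 : ℝ), ∫⁻ θ in Set.Ioo (-Real.pi) Real.pi,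
      ENNReal.ofReal r • g (Complex.polarCoord.symm (r, θ)) =
      (Set.Ioo (0 : ℝ) 1).indicator (fun r => ∑' n, ENNReal.ofReal
        (2 * Real.pi * (‖h n‖ ^ 2 * (r ^ (2 * n + 1) * (1 - r ^ 2) ^ α)))) r := by
    intro r hr
    have hr0 : 0 < r := hr
    have habs : |r| = r := abs_of_pos hr0
    by_cases hr1 : r < 1
    · have hw : 0 ≤ 1 - r ^ 2 := by nlinarith
      have hw' := Real.rpow_nonneg hw α
      have hmem : ∀ θ : ℝ, (r * cexp (θ * I) : ℂ) ∈ Metric.ball (0 : ℂ) 1 := fun θ => by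
        simp [habs, hr1]
      have hrm : r ∈ Set.Ioo (0 : ℝ) 1 := ⟨hr0, hr1⟩
      rw [Set.indicator_of_mem hrm]
      have e3 : ∀ θ : ℝ, ENNReal.ofReal r • g (Complex.polarCoord.symm (r, θ)) =
          ENNReal.ofReal (r * (1 - r ^ 2) ^ α) * ENNReal.ofReal (‖H (r * cexp (θ * I))‖ ^ 2) := by
        intro θ
        rw [hsymm, hg]
        simp only
        rw [Set.indicator_of_mem (hmem θ), hK, Set.piecewise_eq_of_mem _ _ _ (hmem θ), smul_eq_mul,
          ← ENNReal.ofReal_mul hr0.le, ← ENNReal.ofReal_mul (by positivity)]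
        simp only [norm_mul, Complex.norm_real, Complex.norm_exp_ofReal_mul_I, mul_one,
          Real.norm_eq_abs, habs]
        congr 1; ring
      simp_rw [e3]
      have hcont : Continuous (fun θ : ℝ => ‖H (r * cexp (θ * I))‖ ^ 2) := by
        refine (Continuous.norm ?_).pow 2
        exact hc.comp_continuous (by fun_prop) hmem
      have hs := hH.hasSum_circle hr0.le hr1
      rw [lintegral_const_mul _ hcont.measurable.ennreal_ofReal,
        ← ofReal_integral_eq_lintegral_ofReal
        ((hcont.integrableOn_Icc).mono_set Set.Ioo_subset_Icc_self)
        (Filter.Eventually.of_forall fun θ => by positivity), ← integral_Ioc_eq_integral_Ioo,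
        ← intervalIntegral.integral_of_le (by linarith [Real.pi_pos]), ← hs.tsum_eq,
        ENNReal.ofReal_tsum_of_nonneg (fun n => by positivity) hs.summable, ← ENNReal.tsum_mul_left]
      congr 1
      ext n
      rw [← ENNReal.ofReal_mul (by positivity)]
      congr 1; ring
    · have : ∀ θ : ℝ, g (Complex.polarCoord.symm (r, θ)) = 0 := fun θ => by
        rw [hsymm, hg, Set.indicator_of_notMem]
        simp [habs, not_lt.1 hr1]
      simp_rw [this]
      simp [hr1]
  rw [setLIntegral_congr_fun measurableSet_Ioi e2, lintegral_indicator measurableSet_Ioo,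
    Measure.restrict_restrict measurableSet_Ioo,
    Set.inter_eq_left.2 (Set.Ioo_subset_Ioi_self), lintegral_tsum (fun n => by fun_prop)]
  congr 1
  ext n
  have hnn : ∀ r ∈ Set.Ioo (0 : ℝ) 1,
      0 ≤ 2 * Real.pi * (‖h n‖ ^ 2 * (r ^ (2 * n + 1) * (1 - r ^ 2) ^ α)) := fun r hr => by
    have := Real.rpow_nonneg (by nlinarith [hr.1, hr.2] : 0 ≤ 1 - r ^ 2) α
    have := hr.1
    have := Real.pi_pos
    positivity
  have hint := (intervalIntegrable_iff_integrableOn_Ioo_of_le zero_le_one).1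
    (intervalIntegrable_radial hα n)
  rw [← ofReal_integral_eq_lintegral_ofReal ((hint.const_mul (‖h n‖ ^ 2)).const_mul _)
    ((ae_restrict_iff' measurableSet_Ioo).2 (Filter.Eventually.of_forall hnn)),
    integral_const_mul, integral_const_mul, radialMoment,
    intervalIntegral.integral_of_le zero_le_one, integral_Ioc_eq_integral_Ioo]

lemma one_sub_norm_sq_rpow_nonneg {z : ℂ} (hz : z ∈ Metric.ball (0 : ℂ) 1) (α : ℝ) :
    0 ≤ (1 - ‖z‖ ^ 2) ^ α := by
  have : ‖z‖ < 1 := by simpa using hz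
  exact Real.rpow_nonneg (by nlinarith [norm_nonneg z]) α

lemma aestronglyMeasurable_disc_density {H : ℂ → ℂ} (hc : ContinuousOn H (Metric.ball 0 1))
    (α : ℝ) : AEStronglyMeasurable (fun z => ‖H z‖ ^ 2 * (1 - ‖z‖ ^ 2) ^ α)
      (volume.restrict (Metric.ball (0 : ℂ) 1)) := by
  refine ContinuousOn.aestronglyMeasurable ?_ Metric.isOpen_ball.measurableSet
  refine (hc.norm.pow 2).mul (ContinuousOn.rpow_const (by fun_prop) fun z hz => Or.inl ?_)
  have : ‖z‖ < 1 := by simpa using hz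
  nlinarith [norm_nonneg z]

lemma HasDiscSeries.integrableOn_iff_summable {H : ℂ → ℂ} {h : ℕ → ℂ} (hH : HasDiscSeries H h)
    (hc : ContinuousOn H (Metric.ball 0 1)) {α : ℝ} (hα : -1 < α) :
    IntegrableOn (fun z => ‖H z‖ ^ 2 * (1 - ‖z‖ ^ 2) ^ α) (Metric.ball 0 1) ↔
      Summable (fun n => ‖h n‖ ^ 2 * radialMoment α n) := by
  have hpos := fun n => (radialMoment_pos hα n).le
  have hnn : ∀ n, 0 ≤ 2 * Real.pi * (‖h n‖ ^ 2 * radialMoment α n) := fun n => by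
    have := Real.pi_pos; have := hpos n; positivity
  have h1 : IntegrableOn (fun z => ‖H z‖ ^ 2 * (1 - ‖z‖ ^ 2) ^ α) (Metric.ball 0 1) ↔
      ∫⁻ z in Metric.ball (0 : ℂ) 1, ENNReal.ofReal (‖H z‖ ^ 2 * (1 - ‖z‖ ^ 2) ^ α) ≠ ∞ := by
    rw [lintegral_ofReal_ne_top_iff_integrable (aestronglyMeasurable_disc_density hc α)]
    · rfl
    · refine (ae_restrict_iff' Metric.isOpen_ball.measurableSet).2
        (Filter.Eventually.of_forall fun z hz => ?_)
      exact mul_nonneg (sq_nonneg _) (one_sub_norm_sq_rpow_nonneg hz α)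
  rw [h1, hH.lintegral_radial hc hα]
  have h2 : Summable (fun n => ‖h n‖ ^ 2 * radialMoment α n) ↔
      Summable (fun n => 2 * Real.pi * (‖h n‖ ^ 2 * radialMoment α n)) :=
    (summable_mul_left_iff (by positivity)).symm
  rw [h2]
  constructor
  · intro h3
    have := ENNReal.summable_toReal h3
    simpa [ENNReal.toReal_ofReal (hnn _)] using this
  · exact fun h3 => h3.tsum_ofReal_ne_top

lemma HasDiscSeries.hasSum_integral {H : ℂ → ℂ} {h : ℕ → ℂ} (hH : HasDiscSeries H h)
    (hc : ContinuousOn H (Metric.ball 0 1)) {α : ℝ} (hα : -1 < α)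
    (hi : IntegrableOn (fun z => ‖H z‖ ^ 2 * (1 - ‖z‖ ^ 2) ^ α) (Metric.ball 0 1)) :
    HasSum (fun n => 2 * Real.pi * (‖h n‖ ^ 2 * radialMoment α n))
      (∫ z in Metric.ball (0 : ℂ) 1, ‖H z‖ ^ 2 * (1 - ‖z‖ ^ 2) ^ α) := by
  have hnn : ∀ n, 0 ≤ 2 * Real.pi * (‖h n‖ ^ 2 * radialMoment α n) := fun n => by
    have := Real.pi_pos; have := (radialMoment_pos hα n).le; positivity
  have hs := ((hH.integrableOn_iff_summable hc hα).1 hi).mul_left (2 * Real.pi)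
  rw [integral_eq_lintegral_of_nonneg_ae ((ae_restrict_iff' Metric.isOpen_ball.measurableSet).2
        (Filter.Eventually.of_forall fun z hz =>
          mul_nonneg (sq_nonneg _) (one_sub_norm_sq_rpow_nonneg hz α)))
      (aestronglyMeasurable_disc_density hc α), hH.lintegral_radial hc hα,
    ← ENNReal.ofReal_tsum_of_nonneg hnn hs, ENNReal.toReal_ofReal (tsum_nonneg hnn)]
  exact hs.hasSum

section BergmanMatrix

variable {α : ℝ} {W : ℕ → ℝ}

lemma mul_le_mul_of_moment_recurrence (hα : -1 < α) (hpos : ∀ n, 0 < W n)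
    (hrec : ∀ n : ℕ, (n + 2 + α) * W (n + 1) = (n + 1) * W n) (j s t : ℕ) :
    W (j + s) * W (j + t) ≤ W j * W (j + s + t) := by
  induction s with
  | zero => simp
  | succ s ih =>
    have e1 := hrec (j + s)
    have e2 := hrec (j + s + t)
    push_cast at e1 e2
    have d1 : (0 : ℝ) < j + s + 2 + α := by
      have : (0 : ℝ) ≤ j + s := by positivity
      linarith
    have ht : (0 : ℝ) ≤ t := t.cast_nonneg
    have d2 : (0 : ℝ) < j + s + t + 2 + α := by linarith
    have r1 : W (j + (s + 1)) = (j + s + 1) / (j + s + 2 + α) * W (j + s) := by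
      rw [← add_assoc]; field_simp; linarith
    have r2 : W (j + (s + 1) + t) = (j + s + t + 1) / (j + s + t + 2 + α) * W (j + s + t) := by
      rw [show j + (s + 1) + t = j + s + t + 1 by ring]; field_simp; linarith
    have r3 : ((j + s + 1) / (j + s + 2 + α) : ℝ) ≤ (j + s + t + 1) / (j + s + t + 2 + α) := by
      rw [div_le_div_iff₀ d1 d2]; nlinarith
    have r4 : (0 : ℝ) ≤ (j + s + 1) / (j + s + 2 + α) := by positivity
    rw [r1, r2]
    calc _ = (j + s + 1) / (j + s + 2 + α) * (W (j + s) * W (j + t)) := by ring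
      _ ≤ (j + s + t + 1) / (j + s + t + 2 + α) * (W j * W (j + s + t)) :=
        mul_le_mul r3 ih (mul_pos (hpos _) (hpos _)).le (r4.trans r3)
      _ = _ := by ring

lemma sum_inv_of_moment_recurrence (hα : -1 < α) (hpos : ∀ n, 0 < W n)
    (hrec : ∀ n : ℕ, (n + 2 + α) * W (n + 1) = (n + 1) * W n) (n : ℕ) :
    ∑ m ∈ Finset.range (n + 1), (W m)⁻¹ = (n + 2 + α) / ((2 + α) * W n) := by
  have h2 : (2 + α) ≠ 0 := by linarith
  induction n with
  | zero => have := (hpos 0).ne'; simp; field_simp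
  | succ n ih =>
    have h0 := (hpos n).ne'
    have h1 := (hpos (n + 1)).ne'
    have h3 := hrec n
    rw [Finset.sum_range_succ, ih]
    push_cast
    field_simp
    linear_combination (1 : ℝ) * h3

/-- The coefficient matrix of the self-commutator of a Toeplitz operator in the monomial basis,
along total degree `N`. -/
noncomputable def commutatorMatrix (W : ℕ → ℝ) (N n m : ℕ) : ℝ :=
  W N - if N ≤ n + m then W n * W m / W (n + m - N) else 0

lemma commutatorMatrix_comm (N n m : ℕ) :
    commutatorMatrix W N n m = commutatorMatrix W N m n := by
  simp only [commutatorMatrix, add_comm n m, mul_comm (W n)]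

lemma commutatorMatrix_nonneg (hα : -1 < α) (hpos : ∀ n, 0 < W n)
    (hrec : ∀ n : ℕ, (n + 2 + α) * W (n + 1) = (n + 1) * W n) {N n m : ℕ} (hn : n ≤ N)
    (hm : m ≤ N) : 0 ≤ commutatorMatrix W N n m := by
  unfold commutatorMatrix
  split_ifs with h
  · obtain ⟨j, hj⟩ := Nat.exists_eq_add_of_le h
    obtain ⟨s, rfl⟩ : ∃ s, n = j + s := ⟨n - j, by omega⟩
    obtain ⟨t, rfl⟩ : ∃ t, m = j + t := ⟨m - j, by omega⟩
    obtain rfl : N = j + s + t := by omega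
    have := mul_le_mul_of_moment_recurrence hα hpos hrec j s t
    rw [show j + s + (j + t) - (j + s + t) = j by omega, sub_nonneg, div_le_iff₀ (hpos j)]
    linarith
  · simpa using (hpos N).le

lemma sum_commutatorMatrix_div (hα : -1 < α) (hpos : ∀ n, 0 < W n)
    (hrec : ∀ n : ℕ, (n + 2 + α) * W (n + 1) = (n + 1) * W n) {N n : ℕ} (hn : n ≤ N) :
    ∑ m ∈ Finset.range (N + 1), commutatorMatrix W N n m / W m = (N - n) / (2 + α) := by
  have h2 : (2 + α) ≠ 0 := by linarith
  have e1 : ∀ m, commutatorMatrix W N n m / W m =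
      W N * (W m)⁻¹ - if N ≤ n + m then W n * (W (n + m - N))⁻¹ else 0 := fun m => by
    have := (hpos m).ne'
    unfold commutatorMatrix
    split_ifs
    · field_simp
    · simp [div_eq_mul_inv]
  simp_rw [e1]
  rw [Finset.sum_sub_distrib, ← Finset.mul_sum, sum_inv_of_moment_recurrence hα hpos hrec,
    ← Finset.sum_filter]
  have e2 : ∑ m ∈ Finset.range (N + 1) with N ≤ n + m, W n * (W (n + m - N))⁻¹ =
      ∑ i ∈ Finset.range (n + 1), W n * (W i)⁻¹ := by
    refine Finset.sum_nbij' (fun m => n + m - N) (fun i => N - n + i) ?_ ?_ ?_ ?_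
      (fun _ _ => rfl) <;>
      simp only [Finset.mem_filter, Finset.mem_range] <;> intros <;> omega
  rw [e2, ← Finset.mul_sum, sum_inv_of_moment_recurrence hα hpos hrec]
  have h0 := (hpos n).ne'
  have h1 := (hpos N).ne'
  field_simp
  ring

/-- Schur test for a symmetric matrix with nonnegative entries. -/
lemma sum_sum_re_mul_conj_le {ι : Type*} (s : Finset ι) (M : ι → ι → ℝ) (u : ι → ℝ)
    (hu : ∀ i, 0 < u i) (hM : ∀ i ∈ s, ∀ j ∈ s, 0 ≤ M i j) (hsymm : ∀ i j, M i j = M j i)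
    (x : ι → ℂ) :
    ∑ i ∈ s, ∑ j ∈ s, M i j * (x i * (starRingEnd ℂ) (x j)).re ≤
      ∑ i ∈ s, ‖x i‖ ^ 2 * u i * ∑ j ∈ s, M i j / u j := by
  have key : ∀ i ∈ s, ∀ j ∈ s, M i j * (x i * (starRingEnd ℂ) (x j)).re ≤
      (‖x i‖ ^ 2 * u i * (M i j / u j) + ‖x j‖ ^ 2 * u j * (M j i / u i)) / 2 := by
    intro i hi j hj
    have h1 : (x i * (starRingEnd ℂ) (x j)).re ≤ ‖x i‖ * ‖x j‖ := by
      refine (Complex.re_le_norm _).trans ?_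
      simp
    have hi0 := hu i
    have hj0 := hu j
    have h2 : ‖x i‖ * ‖x j‖ ≤ (‖x i‖ ^ 2 * u i / u j + ‖x j‖ ^ 2 * u j / u i) / 2 := by
      have : (‖x i‖ ^ 2 * u i / u j + ‖x j‖ ^ 2 * u j / u i) / 2 - ‖x i‖ * ‖x j‖ =
          (‖x i‖ * u i - ‖x j‖ * u j) ^ 2 / (2 * u i * u j) := by field_simp; ring
      have h3 : 0 ≤ (‖x i‖ * u i - ‖x j‖ * u j) ^ 2 / (2 * u i * u j) := by positivity
      linarith
    calc _ ≤ M i j * ((‖x i‖ ^ 2 * u i / u j + ‖x j‖ ^ 2 * u j / u i) / 2) :=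
          mul_le_mul_of_nonneg_left (h1.trans h2) (hM i hi j hj)
      _ = _ := by rw [hsymm j i]; ring
  refine (Finset.sum_le_sum fun i hi => Finset.sum_le_sum fun j hj => key i hi j hj).trans ?_
  simp_rw [← Finset.sum_div, Finset.sum_add_distrib]
  rw [Finset.sum_comm (f := fun i j => ‖x j‖ ^ 2 * u j * (M j i / u i))]
  simp_rw [Finset.mul_sum]
  linarith

lemma moment_mul_norm_sum_sq_sub_le (hα : -1 < α) (hpos : ∀ n, 0 < W n)
    (hrec : ∀ n : ℕ, (n + 2 + α) * W (n + 1) = (n + 1) * W n) {N : ℕ} (s : Finset ℕ)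
    (hs : ∀ n ∈ s, n ≤ N) (x : ℕ → ℂ) :
    W N * ‖∑ n ∈ s, x n‖ ^ 2 - ∑ n ∈ s, ∑ m ∈ s,
        (if N ≤ n + m then W n * W m / W (n + m - N) * (x n * (starRingEnd ℂ) (x m)).re else 0) ≤
      (1 / (2 + α)) * ∑ n ∈ s, ((N - n : ℕ) : ℝ) * ‖x n‖ ^ 2 * W n := by
  have e1 : ‖∑ n ∈ s, x n‖ ^ 2 = ∑ n ∈ s, ∑ m ∈ s, (x n * (starRingEnd ℂ) (x m)).re := by
    have : ((‖∑ n ∈ s, x n‖ ^ 2 : ℝ) : ℂ) = ∑ n ∈ s, ∑ m ∈ s, (x n * (starRingEnd ℂ) (x m)) := by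
      rw [← Complex.normSq_eq_norm_sq, ← Complex.mul_conj, map_sum, Finset.sum_mul_sum]
    rw [← Complex.ofReal_re (‖∑ n ∈ s, x n‖ ^ 2), this]
    simp_rw [Complex.re_sum]
  have e2 : W N * ‖∑ n ∈ s, x n‖ ^ 2 - ∑ n ∈ s, ∑ m ∈ s,
        (if N ≤ n + m then W n * W m / W (n + m - N) * (x n * (starRingEnd ℂ) (x m)).re else 0) =
      ∑ n ∈ s, ∑ m ∈ s, commutatorMatrix W N n m * (x n * (starRingEnd ℂ) (x m)).re := by
    rw [e1, Finset.mul_sum, ← Finset.sum_sub_distrib]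
    refine Finset.sum_congr rfl fun n _ => ?_
    rw [Finset.mul_sum, ← Finset.sum_sub_distrib]
    refine Finset.sum_congr rfl fun m _ => ?_
    unfold commutatorMatrix
    split_ifs <;> ring
  rw [e2]
  refine (sum_sum_re_mul_conj_le s _ W hpos
    (fun i hi j hj => commutatorMatrix_nonneg hα hpos hrec (hs i hi) (hs j hj))
    (commutatorMatrix_comm N) x).trans ?_
  rw [Finset.mul_sum]
  refine Finset.sum_le_sum fun n hn => ?_
  have h1 : ∑ m ∈ s, commutatorMatrix W N n m / W m ≤ (N - n) / (2 + α) := by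
    rw [← sum_commutatorMatrix_div hα hpos hrec (hs n hn)]
    refine Finset.sum_le_sum_of_subset_of_nonneg
      (fun m hm => Finset.mem_range.2 (Nat.lt_succ_of_le (hs m hm))) (fun m hm _ => ?_)
    exact div_nonneg (commutatorMatrix_nonneg hα hpos hrec (hs n hn)
      (Nat.lt_succ_iff.1 (Finset.mem_range.1 hm))) (hpos m).le
  calc _ ≤ ‖x n‖ ^ 2 * W n * ((N - n) / (2 + α)) :=
        mul_le_mul_of_nonneg_left h1 (mul_nonneg (sq_nonneg _) (hpos n).le)
    _ = _ := by rw [Nat.cast_sub (hs n hn)]; ring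

/-- Coefficients of the orthogonal projection of `conj Ψ * F` onto polynomials of degree `< L`,
where `Ψ` has coefficients `b` and `F` is the polynomial `∑ n < L, a n * z ^ n`. -/
noncomputable def toeplitzCoeff (W : ℕ → ℝ) (b a : ℕ → ℂ) (L m : ℕ) : ℂ :=
  (W m : ℂ)⁻¹ * ∑ n ∈ Finset.range L with m ≤ n, a n * (starRingEnd ℂ) (b (n - m)) * W n

lemma sum_moment_mul_norm_toeplitzCoeff_sq (hpos : ∀ n, 0 < W n) (b a : ℕ → ℂ) {L T : ℕ}
    (hT : 2 * L ≤ T) :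
    ∑ m ∈ Finset.range L, W m * ‖toeplitzCoeff W b a L m‖ ^ 2 =
      ∑ N ∈ Finset.range T, ∑ n ∈ Finset.range L with n ≤ N, ∑ m ∈ Finset.range L with m ≤ N,
        (if N ≤ n + m then W n * W m / W (n + m - N) *
          ((b (N - n) * a n) * (starRingEnd ℂ) (b (N - m) * a m)).re else 0) := by
  have e1 : ∀ j, W j * ‖toeplitzCoeff W b a L j‖ ^ 2 =
      ∑ n ∈ Finset.range L, ∑ m ∈ Finset.range L, (if j ≤ n ∧ j ≤ m then W n * W m / W j *
        ((b (m - j) * a n) * (starRingEnd ℂ) (b (n - j) * a m)).re else 0) := by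
    intro j
    have hj : (W j : ℂ) ≠ 0 := by exact_mod_cast (hpos j).ne'
    have : ((W j * ‖toeplitzCoeff W b a L j‖ ^ 2 : ℝ) : ℂ) =
        ∑ n ∈ Finset.range L, ∑ m ∈ Finset.range L, (if j ≤ n ∧ j ≤ m then
        ((W n * W m / W j : ℝ) : ℂ) *
        ((b (m - j) * a n) * (starRingEnd ℂ) (b (n - j) * a m)) else 0) := by
      rw [Complex.ofReal_mul, ← Complex.normSq_eq_norm_sq, ← Complex.mul_conj, toeplitzCoeff,
        map_mul, map_sum, map_inv₀, Complex.conj_ofReal, Finset.sum_filter, Finset.sum_filter]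
      rw [show ∀ A B : ℂ, (W j : ℂ) * ((W j : ℂ)⁻¹ * A * ((W j : ℂ)⁻¹ * B)) = (W j : ℂ)⁻¹ * (A * B)
        from fun A B => by field_simp, Finset.sum_mul_sum, Finset.mul_sum]
      refine Finset.sum_congr rfl fun n _ => ?_
      rw [Finset.mul_sum]
      refine Finset.sum_congr rfl fun m _ => ?_
      by_cases h1 : j ≤ n <;> by_cases h2 : j ≤ m <;> simp [h1, h2]
      field_simp
    rw [← Complex.ofReal_re (W j * _), this]
    simp_rw [Complex.re_sum]
    refine Finset.sum_congr rfl fun n _ => Finset.sum_congr rfl fun m _ => ?_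
    split_ifs
    · rw [Complex.re_ofReal_mul]
    · rfl
  simp_rw [e1]
  have e2 : ∀ N, ∑ n ∈ Finset.range L with n ≤ N, ∑ m ∈ Finset.range L with m ≤ N,
        (if N ≤ n + m then W n * W m / W (n + m - N) *
          ((b (N - n) * a n) * (starRingEnd ℂ) (b (N - m) * a m)).re else 0) =
      ∑ n ∈ Finset.range L, ∑ m ∈ Finset.range L, if n ≤ N ∧ m ≤ N ∧ N ≤ n + m then
        W n * W m / W (n + m - N) *
          ((b (N - n) * a n) * (starRingEnd ℂ) (b (N - m) * a m)).re else 0 := by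
    intro N
    rw [Finset.sum_filter]
    refine Finset.sum_congr rfl fun n _ => ?_
    by_cases h1 : n ≤ N
    · rw [if_pos h1, Finset.sum_filter]
      refine Finset.sum_congr rfl fun m _ => ?_
      by_cases h2 : m ≤ N <;> simp [h1, h2]
    · simp [h1]
  simp_rw [e2]
  rw [Finset.sum_comm, Finset.sum_comm (s := Finset.range T)]
  refine Finset.sum_congr rfl fun n hn => ?_
  rw [Finset.sum_comm, Finset.sum_comm (s := Finset.range T)]
  refine Finset.sum_congr rfl fun m hm => ?_
  rw [Finset.mem_range] at hn hm
  rw [← Finset.sum_filter, ← Finset.sum_filter]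
  refine Finset.sum_nbij' (fun j => n + m - j) (fun N => n + m - N) ?_ ?_ ?_ ?_ ?_
  · simp only [Finset.mem_filter, Finset.mem_range]; intros; omega
  · simp only [Finset.mem_filter, Finset.mem_range]; intros; omega
  · simp only [Finset.mem_filter, Finset.mem_range]; intros; omega
  · simp only [Finset.mem_filter, Finset.mem_range]; intros; omega
  · simp only [Finset.mem_filter, Finset.mem_range]
    intro j hj
    rw [show n + m - (n + m - j) = j by omega, show n + m - j - n = m - j by omega,
      show n + m - j - m = n - j by omega]

lemma sum_moment_mul_norm_coeff_sq_sub_le (hα : -1 < α) (hpos : ∀ n, 0 < W n)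
    (hrec : ∀ n : ℕ, (n + 2 + α) * W (n + 1) = (n + 1) * W n) (b a : ℕ → ℂ) {L T : ℕ}
    (hT : 2 * L ≤ T) :
    ∑ N ∈ Finset.range T, W N * ‖∑ n ∈ Finset.range L with n ≤ N, b (N - n) * a n‖ ^ 2 -
        ∑ m ∈ Finset.range L, W m * ‖toeplitzCoeff W b a L m‖ ^ 2 ≤
      (1 / (2 + α)) * (∑ k ∈ Finset.range T, k * ‖b k‖ ^ 2) *
        ∑ n ∈ Finset.range L, ‖a n‖ ^ 2 * W n := by
  have h2 : 0 < 2 + α := by linarith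
  rw [sum_moment_mul_norm_toeplitzCoeff_sq hpos b a hT, ← Finset.sum_sub_distrib]
  refine (Finset.sum_le_sum fun N _ => moment_mul_norm_sum_sq_sub_le hα hpos hrec
    ((Finset.range L).filter (· ≤ N)) (fun n hn => (Finset.mem_filter.1 hn).2)
    (fun n => b (N - n) * a n)).trans ?_
  rw [← Finset.mul_sum, mul_assoc]
  refine mul_le_mul_of_nonneg_left ?_ (by positivity)
  simp_rw [Finset.sum_filter]
  rw [Finset.sum_comm, Finset.mul_sum]
  refine Finset.sum_le_sum fun n _ => ?_
  rw [← Finset.sum_filter]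
  have e1 : ∑ N ∈ Finset.range T with n ≤ N, ((N - n : ℕ) : ℝ) * ‖b (N - n) * a n‖ ^ 2 * W n =
      (∑ N ∈ Finset.range T with n ≤ N, ((N - n : ℕ) : ℝ) * ‖b (N - n)‖ ^ 2) *
        (‖a n‖ ^ 2 * W n) := by
    rw [Finset.sum_mul]
    refine Finset.sum_congr rfl fun N _ => ?_
    rw [norm_mul]; ring
  rw [e1]
  refine mul_le_mul_of_nonneg_right ?_ (mul_nonneg (sq_nonneg _) (hpos n).le)
  rw [← Finset.sum_image (g := fun N => N - n) (f := fun k : ℕ => (k : ℝ) * ‖b k‖ ^ 2)]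
  · refine Finset.sum_le_sum_of_subset_of_nonneg (fun k hk => ?_) (fun k _ _ => by positivity)
    simp only [Finset.mem_image, Finset.mem_filter, Finset.mem_range] at hk ⊢
    omega
  · intro x hx y hy hxy
    simp only [Finset.coe_filter, Set.mem_ofPred_eq] at hx hy
    simp only at hxy
    omega

end BergmanMatrix

lemma hasDiscSeries_taylor {H : ℂ → ℂ} (hH : DifferentiableOn ℂ H (Metric.ball 0 1)) :
    HasDiscSeries H (fun n => ((n.factorial : ℂ))⁻¹ * iteratedDeriv n H 0) := by
  intro z hz
  have := Complex.hasSum_taylorSeries_on_ball (r := 1) (by simpa using hH) (by simpa using hz)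
  simp only [sub_zero, smul_eq_mul] at this
  convert! this using 2 with n
  ring

lemma exists_hasDiscSeries_deriv {H : ℂ → ℂ} (hH : DifferentiableOn ℂ H (Metric.ball 0 1)) :
    ∃ h : ℕ → ℂ, HasDiscSeries H h ∧ HasDiscSeries (deriv H) (fun n => (n + 1) * h (n + 1)) := by
  refine ⟨_, hasDiscSeries_taylor hH, ?_⟩
  convert! hasDiscSeries_taylor (hH.deriv Metric.isOpen_ball) using 2 with n
  rw [iteratedDeriv_succ', Nat.factorial_succ]
  have h1 : (n.factorial : ℂ) ≠ 0 := by exact_mod_cast n.factorial_ne_zero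
  have h2 : (n + 1 : ℂ) ≠ 0 := by exact_mod_cast n.succ_ne_zero
  push_cast
  field_simp

lemma HasDiscSeries.add {H K : ℂ → ℂ} {h k : ℕ → ℂ} (hH : HasDiscSeries H h)
    (hK : HasDiscSeries K k) : HasDiscSeries (fun z => H z + K z) (fun n => h n + k n) := by
  intro z hz
  simpa only [add_mul] using (hH z hz).add (hK z hz)

lemma HasDiscSeries.sub {H K : ℂ → ℂ} {h k : ℕ → ℂ} (hH : HasDiscSeries H h)
    (hK : HasDiscSeries K k) : HasDiscSeries (fun z => H z - K z) (fun n => h n - k n) := by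
  intro z hz
  simpa only [sub_mul] using (hH z hz).sub (hK z hz)

/-- The polynomial `∑ n < L, a n * z ^ n`. -/
noncomputable def discPoly (a : ℕ → ℂ) (L : ℕ) (z : ℂ) : ℂ := ∑ n ∈ Finset.range L, a n * z ^ n

lemma continuous_discPoly (a : ℕ → ℂ) (L : ℕ) : Continuous (discPoly a L) := by
  unfold discPoly; fun_prop

lemma differentiable_discPoly (a : ℕ → ℂ) (L : ℕ) : Differentiable ℂ (discPoly a L) := by
  unfold discPoly; fun_prop

lemma hasDiscSeries_discPoly (a : ℕ → ℂ) (L : ℕ) :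
    HasDiscSeries (discPoly a L) (fun n => if n < L then a n else 0) := by
  intro z _
  have : discPoly a L z = ∑ n ∈ Finset.range L, (if n < L then a n else 0) * z ^ n := by
    refine Finset.sum_congr rfl fun n hn => ?_
    rw [if_pos (Finset.mem_range.1 hn)]
  rw [this]
  refine hasSum_sum_of_ne_finset_zero fun n hn => ?_
  simp [Finset.mem_range.not.1 hn]

lemma HasDiscSeries.mul_discPoly {Ψ : ℂ → ℂ} {b : ℕ → ℂ} (hΨ : HasDiscSeries Ψ b) (a : ℕ → ℂ)
    (L : ℕ) : HasDiscSeries (fun z => Ψ z * discPoly a L z)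
      (fun N => ∑ n ∈ Finset.range L with n ≤ N, b (N - n) * a n) := by
  intro z hz
  have h1 : ∀ n ∈ Finset.range L,
      HasSum (fun N => (if n ≤ N then b (N - n) * a n else 0) * z ^ N)
        (Ψ z * (a n * z ^ n)) := by
    intro n _
    rw [← (add_left_injective n).hasSum_iff]
    · convert! (hΨ z hz).mul_right (a n * z ^ n) using 2 with N
      simp [pow_add]; ring
    · intro N hN
      have : ¬ n ≤ N := fun h => hN ⟨N - n, Nat.sub_add_cancel h⟩
      simp [this]
  have h2 := hasSum_sum h1
  rw [← Finset.mul_sum] at h2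
  simpa only [Finset.sum_filter, Finset.sum_mul, discPoly] using h2

lemma integrableOn_discPoly (a : ℕ → ℂ) (L : ℕ) {α : ℝ} (hα : -1 < α) :
    IntegrableOn (fun z => ‖discPoly a L z‖ ^ 2 * (1 - ‖z‖ ^ 2) ^ α) (Metric.ball 0 1) := by
  rw [(hasDiscSeries_discPoly a L).integrableOn_iff_summable
    (continuous_discPoly a L).continuousOn hα]
  refine summable_of_ne_finset_zero (s := Finset.range L) fun n hn => ?_
  simp [Finset.mem_range.not.1 hn]

lemma IntegrableOn.bounded_mul_disc {Ψ F : ℂ → ℂ} {α C : ℝ}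
    (hΨ : ContinuousOn Ψ (Metric.ball 0 1)) (hF : ContinuousOn F (Metric.ball 0 1))
    (hC : ∀ z ∈ Metric.ball (0 : ℂ) 1, ‖Ψ z‖ ≤ C)
    (hi : IntegrableOn (fun z => ‖F z‖ ^ 2 * (1 - ‖z‖ ^ 2) ^ α) (Metric.ball 0 1)) :
    IntegrableOn (fun z => ‖Ψ z * F z‖ ^ 2 * (1 - ‖z‖ ^ 2) ^ α) (Metric.ball 0 1) := by
  refine Integrable.mono' (hi.const_mul (C ^ 2))
    (aestronglyMeasurable_disc_density (hΨ.mul hF) α)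
    ((ae_restrict_iff' Metric.isOpen_ball.measurableSet).2
      (Filter.Eventually.of_forall fun z hz => ?_))
  have h1 := one_sub_norm_sq_rpow_nonneg hz α
  have h2 : ‖Ψ z‖ ^ 2 ≤ C ^ 2 := pow_le_pow_left₀ (norm_nonneg _) (hC z hz) 2
  rw [Real.norm_of_nonneg (by positivity), norm_mul, mul_pow, mul_assoc]
  exact mul_le_mul_of_nonneg_right h2 (by positivity)

lemma IntegrableOn.add_disc {F G : ℂ → ℂ} {α : ℝ}
    (hF : ContinuousOn F (Metric.ball 0 1)) (hG : ContinuousOn G (Metric.ball 0 1))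
    (hiF : IntegrableOn (fun z => ‖F z‖ ^ 2 * (1 - ‖z‖ ^ 2) ^ α) (Metric.ball 0 1))
    (hiG : IntegrableOn (fun z => ‖G z‖ ^ 2 * (1 - ‖z‖ ^ 2) ^ α) (Metric.ball 0 1)) :
    IntegrableOn (fun z => ‖F z + G z‖ ^ 2 * (1 - ‖z‖ ^ 2) ^ α) (Metric.ball 0 1) := by
  refine Integrable.mono' ((hiF.const_mul 2).add (hiG.const_mul 2))
    (aestronglyMeasurable_disc_density (hF.add hG) α)
    ((ae_restrict_iff' Metric.isOpen_ball.measurableSet).2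
      (Filter.Eventually.of_forall fun z hz => ?_))
  have h1 := one_sub_norm_sq_rpow_nonneg hz α
  have h2 : ‖F z + G z‖ ^ 2 ≤ 2 * ‖F z‖ ^ 2 + 2 * ‖G z‖ ^ 2 := by
    have := pow_le_pow_left₀ (norm_nonneg _) (norm_add_le (F z) (G z)) 2
    nlinarith [sq_nonneg (‖F z‖ - ‖G z‖)]
  rw [Real.norm_of_nonneg (by positivity)]
  have := mul_le_mul_of_nonneg_right h2 h1
  simp only [Pi.add_apply]
  linarith

lemma norm_conj_mul_sub_sq (p f g : ℂ) :
    ‖(starRingEnd ℂ) p * f - g‖ ^ 2 =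
      ‖p * f‖ ^ 2 + ‖g‖ ^ 2 + ‖f‖ ^ 2 + ‖p * g‖ ^ 2 - ‖f + p * g‖ ^ 2 := by
  simp only [← Complex.normSq_eq_norm_sq, Complex.normSq_apply, Complex.sub_re, Complex.sub_im,
    Complex.mul_re, Complex.mul_im, Complex.add_re, Complex.add_im, Complex.conj_re,
    Complex.conj_im]
  ring

lemma sum_moment_re_mul_conj_toeplitzCoeff {W : ℕ → ℝ} (hpos : ∀ n, 0 < W n) (b a : ℕ → ℂ)
    (L : ℕ) :
    ∑ N ∈ Finset.range L, W N * (a N * (starRingEnd ℂ)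
      (∑ m ∈ Finset.range L with m ≤ N, b (N - m) * toeplitzCoeff W b a L m)).re =
    ∑ m ∈ Finset.range L, W m * ‖toeplitzCoeff W b a L m‖ ^ 2 := by
  set g := toeplitzCoeff W b a L with hg
  have h1 : ∑ N ∈ Finset.range L, (W N : ℂ) * (a N * (starRingEnd ℂ)
      (∑ m ∈ Finset.range L with m ≤ N, b (N - m) * g m)) =
      ∑ m ∈ Finset.range L, (W m : ℂ) * ((‖g m‖ ^ 2 : ℝ) : ℂ) := by
    simp_rw [Finset.sum_filter, map_sum, Finset.mul_sum]
    rw [Finset.sum_comm]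
    refine Finset.sum_congr rfl fun m _ => ?_
    have hm : (W m : ℂ) ≠ 0 := by exact_mod_cast (hpos m).ne'
    have h2 : (W m : ℂ) * g m =
        ∑ n ∈ Finset.range L with m ≤ n, a n * (starRingEnd ℂ) (b (n - m)) * W n := by
      rw [hg, toeplitzCoeff]; field_simp
    rw [← Complex.normSq_eq_norm_sq, ← Complex.mul_conj, ← mul_assoc, h2, Finset.sum_filter,
      Finset.sum_mul]
    refine Finset.sum_congr rfl fun n _ => ?_
    split_ifs
    · rw [map_mul]; ring
    · simp
  have h3 := congrArg Complex.re h1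
  simp_rw [Complex.re_sum, Complex.re_ofReal_mul, Complex.ofReal_re] at h3
  exact h3

lemma integral_conj_mul_discPoly_sub_le {α : ℝ} (hα : -1 < α) {Ψ : ℂ → ℂ} {b : ℕ → ℂ}
    (hΨc : ContinuousOn Ψ (Metric.ball 0 1)) (hΨ : HasDiscSeries Ψ b) {C : ℝ}
    (hC : ∀ z ∈ Metric.ball (0 : ℂ) 1, ‖Ψ z‖ ≤ C) {D : ℝ}
    (hD : ∀ T, ∑ k ∈ Finset.range T, k * ‖b k‖ ^ 2 ≤ D) (a : ℕ → ℂ) (L : ℕ) :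
    ∫ z in Metric.ball (0 : ℂ) 1, ‖(starRingEnd ℂ) (Ψ z) * discPoly a L z -
        discPoly (toeplitzCoeff (radialMoment α) b a L) L z‖ ^ 2 * (1 - ‖z‖ ^ 2) ^ α ≤
      2 * Real.pi * ((1 / (2 + α)) * D *
        ∑ n ∈ Finset.range L, ‖a n‖ ^ 2 * radialMoment α n) := by
  set W := radialMoment α with hW
  have hpos : ∀ n, 0 < W n := radialMoment_pos hα
  have hrec := radialMoment_succ hα
  set g := toeplitzCoeff W b a L with hg
  set F := discPoly a L
  set G := discPoly g L
  have hFc : ContinuousOn F (Metric.ball 0 1) := (continuous_discPoly a L).continuousOn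
  have hGc : ContinuousOn G (Metric.ball 0 1) := (continuous_discPoly g L).continuousOn
  have iF := integrableOn_discPoly a L hα
  have iG := integrableOn_discPoly g L hα
  have iΨF := IntegrableOn.bounded_mul_disc hΨc hFc hC iF
  have iΨG := IntegrableOn.bounded_mul_disc hΨc hGc hC iG
  have iS := IntegrableOn.add_disc hFc (hΨc.mul hGc) iF iΨG
  have sF := (hasDiscSeries_discPoly a L).hasSum_integral hFc hα iF
  have sG := (hasDiscSeries_discPoly g L).hasSum_integral hGc hα iG
  have sΨF := (hΨ.mul_discPoly a L).hasSum_integral (hΨc.mul hFc) hα iΨF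
  have sΨG := (hΨ.mul_discPoly g L).hasSum_integral (hΨc.mul hGc) hα iΨG
  have sS := ((hasDiscSeries_discPoly a L).add (hΨ.mul_discPoly g L)).hasSum_integral
    (hFc.add (hΨc.mul hGc)) hα iS
  have hsplit : ∫ z in Metric.ball (0 : ℂ) 1,
      ‖(starRingEnd ℂ) (Ψ z) * F z - G z‖ ^ 2 * (1 - ‖z‖ ^ 2) ^ α =
      (∫ z in Metric.ball (0 : ℂ) 1, ‖Ψ z * F z‖ ^ 2 * (1 - ‖z‖ ^ 2) ^ α) +
      (∫ z in Metric.ball (0 : ℂ) 1, ‖G z‖ ^ 2 * (1 - ‖z‖ ^ 2) ^ α) +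
      (∫ z in Metric.ball (0 : ℂ) 1, ‖F z‖ ^ 2 * (1 - ‖z‖ ^ 2) ^ α) +
      (∫ z in Metric.ball (0 : ℂ) 1, ‖Ψ z * G z‖ ^ 2 * (1 - ‖z‖ ^ 2) ^ α) -
      (∫ z in Metric.ball (0 : ℂ) 1, ‖F z + Ψ z * G z‖ ^ 2 * (1 - ‖z‖ ^ 2) ^ α) := by
    have e : (fun z => ‖(starRingEnd ℂ) (Ψ z) * F z - G z‖ ^ 2 * (1 - ‖z‖ ^ 2) ^ α) = fun z =>
        ‖Ψ z * F z‖ ^ 2 * (1 - ‖z‖ ^ 2) ^ α + ‖G z‖ ^ 2 * (1 - ‖z‖ ^ 2) ^ α +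
        ‖F z‖ ^ 2 * (1 - ‖z‖ ^ 2) ^ α + ‖Ψ z * G z‖ ^ 2 * (1 - ‖z‖ ^ 2) ^ α -
        ‖F z + Ψ z * G z‖ ^ 2 * (1 - ‖z‖ ^ 2) ^ α := by
      ext z
      rw [norm_conj_mul_sub_sq]
      ring
    rw [e, integral_sub, integral_add, integral_add, integral_add]
    exacts [iΨF, iG, iΨF.add iG, iF, (iΨF.add iG).add iF, iΨG,
      ((iΨF.add iG).add iF).add iΨG, iS]
  have hcross : (∫ z in Metric.ball (0 : ℂ) 1, ‖G z‖ ^ 2 * (1 - ‖z‖ ^ 2) ^ α) +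
      (∫ z in Metric.ball (0 : ℂ) 1, ‖F z‖ ^ 2 * (1 - ‖z‖ ^ 2) ^ α) +
      (∫ z in Metric.ball (0 : ℂ) 1, ‖Ψ z * G z‖ ^ 2 * (1 - ‖z‖ ^ 2) ^ α) -
      (∫ z in Metric.ball (0 : ℂ) 1, ‖F z + Ψ z * G z‖ ^ 2 * (1 - ‖z‖ ^ 2) ^ α) =
      - (2 * Real.pi * ∑ m ∈ Finset.range L, W m * ‖g m‖ ^ 2) := by
    have s1 := ((sG.add sF).add sΨG).sub sS
    rw [← s1.tsum_eq, tsum_eq_sum (s := Finset.range L)]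
    · have e : ∀ N ∈ Finset.range L, 2 * Real.pi * (‖if N < L then g N else 0‖ ^ 2 * W N) +
          2 * Real.pi * (‖if N < L then a N else 0‖ ^ 2 * W N) +
          2 * Real.pi * (‖∑ n ∈ Finset.range L with n ≤ N, b (N - n) * g n‖ ^ 2 * W N) -
          2 * Real.pi * (‖(if N < L then a N else 0) +
            ∑ n ∈ Finset.range L with n ≤ N, b (N - n) * g n‖ ^ 2 * W N) =
          2 * Real.pi * (W N * ‖g N‖ ^ 2) - 2 * Real.pi * (2 * (W N * (a N * (starRingEnd ℂ)
            (∑ m ∈ Finset.range L with m ≤ N, b (N - m) * g m)).re)) := by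
        intro N hN
        rw [if_pos (Finset.mem_range.1 hN), if_pos (Finset.mem_range.1 hN)]
        generalize ∑ n ∈ Finset.range L with n ≤ N, b (N - n) * g n = d
        simp only [← Complex.normSq_eq_norm_sq]
        rw [Complex.normSq_add]
        ring
      rw [Finset.sum_congr rfl e, Finset.sum_sub_distrib]
      simp_rw [← Finset.mul_sum]
      rw [sum_moment_re_mul_conj_toeplitzCoeff hpos b a L, ← hg]
      ring
    · intro N hN
      rw [if_neg (Finset.mem_range.not.1 hN), if_neg (Finset.mem_range.not.1 hN)]
      simp
  have hbound : (∫ z in Metric.ball (0 : ℂ) 1, ‖Ψ z * F z‖ ^ 2 * (1 - ‖z‖ ^ 2) ^ α) ≤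
      2 * Real.pi * ((1 / (2 + α)) * D * ∑ n ∈ Finset.range L, ‖a n‖ ^ 2 * W n) +
      2 * Real.pi * ∑ m ∈ Finset.range L, W m * ‖g m‖ ^ 2 := by
    refine le_of_tendsto sΨF.tendsto_sum_nat (Filter.eventually_atTop.2 ⟨2 * L, fun T hT => ?_⟩)
    rw [← Finset.mul_sum, ← mul_add]
    refine mul_le_mul_of_nonneg_left ?_ (by positivity)
    have h1 := sum_moment_mul_norm_coeff_sq_sub_le hα hpos hrec b a hT
    have h2 : (1 / (2 + α)) * (∑ k ∈ Finset.range T, k * ‖b k‖ ^ 2) *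
        ∑ n ∈ Finset.range L, ‖a n‖ ^ 2 * W n ≤
        (1 / (2 + α)) * D * ∑ n ∈ Finset.range L, ‖a n‖ ^ 2 * W n := by
      have : 0 ≤ 1 / (2 + α) := by
        have : 0 < 2 + α := by linarith
        positivity
      exact mul_le_mul_of_nonneg_right (mul_le_mul_of_nonneg_left (hD T) this)
        (Finset.sum_nonneg fun n _ => mul_nonneg (sq_nonneg _) (hpos n).le)
    simp only [← hW]
    simp_rw [mul_comm _ (W _)] at h1 h2 ⊢
    linarith
  rw [hsplit]
  linarith

lemma sum_mul_norm_coeff_sq_le {Ψ : ℂ → ℂ} (hΨd : DifferentiableOn ℂ Ψ (Metric.ball 0 1))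
    {b : ℕ → ℂ} (hb : HasDiscSeries (deriv Ψ) (fun n => (n + 1) * b (n + 1)))
    (hi : IntegrableOn (fun z => ‖deriv Ψ z‖ ^ 2) (Metric.ball 0 1)) (T : ℕ) :
    ∑ k ∈ Finset.range T, k * ‖b k‖ ^ 2 ≤
      (∫ z in Metric.ball (0 : ℂ) 1, ‖deriv Ψ z‖ ^ 2) / Real.pi := by
  have h1 := hb.hasSum_integral (hΨd.deriv Metric.isOpen_ball).continuousOn
    (α := 0) (by norm_num) (by simpa using hi)
  simp only [Real.rpow_zero, mul_one, radialMoment_zero_left] at h1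
  have h2 : ∀ n : ℕ, 2 * Real.pi * (‖(n + 1 : ℂ) * b (n + 1)‖ ^ 2 * (1 / (2 * (n + 1)))) =
      Real.pi * ((n + 1) * ‖b (n + 1)‖ ^ 2) := fun n => by
    have h3 : ‖(n + 1 : ℂ)‖ = n + 1 := by exact_mod_cast Complex.norm_natCast (n + 1)
    have h4 : (n + 1 : ℝ) ≠ 0 := by positivity
    rw [norm_mul, h3]
    field_simp
  simp_rw [h2] at h1
  have hpi := Real.pi_pos
  rw [le_div_iff₀ hpi, mul_comm]
  cases T with
  | zero => simpa using integral_nonneg fun z => sq_nonneg ‖deriv Ψ z‖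
  | succ T =>
    rw [Finset.sum_range_succ']
    have := sum_le_hasSum (Finset.range T) (fun n _ => by positivity) h1
    rw [← Finset.mul_sum] at this
    simpa using this

lemma norm_add_sq_le_of_pos (x y : ℂ) {δ : ℝ} (hδ : 0 < δ) :
    ‖x + y‖ ^ 2 ≤ (1 + δ) * ‖x‖ ^ 2 + (1 + 1 / δ) * ‖y‖ ^ 2 := by
  have h1 := pow_le_pow_left₀ (norm_nonneg _) (norm_add_le x y) 2
  have h2 : 0 ≤ 1 / δ * (δ * ‖x‖ - ‖y‖) ^ 2 := by positivity
  have h3 : 1 / δ * (δ * ‖x‖ - ‖y‖) ^ 2 =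
      δ * ‖x‖ ^ 2 + 1 / δ * ‖y‖ ^ 2 - 2 * ‖x‖ * ‖y‖ := by
    field_simp
    ring
  nlinarith

lemma HasDiscSeries.tendsto_integral_sub_discPoly {F : ℂ → ℂ} {a : ℕ → ℂ}
    (hF : HasDiscSeries F a) (hc : ContinuousOn F (Metric.ball 0 1)) {α : ℝ} (hα : -1 < α)
    (hi : IntegrableOn (fun z => ‖F z‖ ^ 2 * (1 - ‖z‖ ^ 2) ^ α) (Metric.ball 0 1)) :
    (∀ L, IntegrableOn (fun z => ‖F z - discPoly a L z‖ ^ 2 * (1 - ‖z‖ ^ 2) ^ α)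
      (Metric.ball 0 1)) ∧
    Filter.Tendsto (fun L => ∫ z in Metric.ball (0 : ℂ) 1,
      ‖F z - discPoly a L z‖ ^ 2 * (1 - ‖z‖ ^ 2) ^ α) Filter.atTop (nhds 0) := by
  have hi' : ∀ L, IntegrableOn (fun z => ‖F z - discPoly a L z‖ ^ 2 * (1 - ‖z‖ ^ 2) ^ α)
      (Metric.ball 0 1) := fun L => by
    have h := IntegrableOn.add_disc hc (continuous_discPoly a L).neg.continuousOn hi
      (by simpa using integrableOn_discPoly a L hα)
    simpa [sub_eq_add_neg] using h
  refine ⟨hi', ?_⟩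
  have hs := hF.hasSum_integral hc hα hi
  have key : ∀ L, ∫ z in Metric.ball (0 : ℂ) 1,
      ‖F z - discPoly a L z‖ ^ 2 * (1 - ‖z‖ ^ 2) ^ α =
      (∫ z in Metric.ball (0 : ℂ) 1, ‖F z‖ ^ 2 * (1 - ‖z‖ ^ 2) ^ α) -
        ∑ n ∈ Finset.range L, 2 * Real.pi * (‖a n‖ ^ 2 * radialMoment α n) := fun L => by
    have h1 := (hF.sub (hasDiscSeries_discPoly a L)).hasSum_integral
      (hc.sub (continuous_discPoly a L).continuousOn) hα (hi' L)
    have h2 : HasSum (fun n => if n < L then 2 * Real.pi * (‖a n‖ ^ 2 * radialMoment α n) else 0)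
        (∑ n ∈ Finset.range L, 2 * Real.pi * (‖a n‖ ^ 2 * radialMoment α n)) := by
      have h3 := hasSum_sum_of_ne_finset_zero (L := .unconditional ℕ) (s := Finset.range L)
        (f := fun n => if n < L then 2 * Real.pi * (‖a n‖ ^ 2 * radialMoment α n) else 0)
        fun n hn => if_neg (Finset.mem_range.not.1 hn)
      rwa [Finset.sum_congr rfl fun n hn => if_pos (Finset.mem_range.1 hn)] at h3
    have h3 := h1.add h2
    refine eq_sub_of_add_eq (h3.unique ?_)
    convert! hs using 2 with n
    split_ifs <;> simp
  simp_rw [key]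
  have h := hs.tendsto_sum_nat.const_sub
    (∫ z in Metric.ball (0 : ℂ) 1, ‖F z‖ ^ 2 * (1 - ‖z‖ ^ 2) ^ α)
  rwa [sub_self] at h

lemma exists_integral_conj_mul_sub_le_add {α : ℝ} (hα : -1 < α) {Ψ F : ℂ → ℂ}
    (hΨ : DifferentiableOn ℂ Ψ (Metric.ball 0 1)) {C : ℝ}
    (hC : ∀ z ∈ Metric.ball (0 : ℂ) 1, ‖Ψ z‖ ≤ C)
    (hΨi : IntegrableOn (fun z => ‖deriv Ψ z‖ ^ 2) (Metric.ball 0 1))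
    (hF : DifferentiableOn ℂ F (Metric.ball 0 1))
    (hFi : IntegrableOn (fun z => ‖F z‖ ^ 2 * (1 - ‖z‖ ^ 2) ^ α) (Metric.ball 0 1))
    {ε : ℝ} (hε : 0 < ε) :
    ∃ G : ℂ → ℂ, Differentiable ℂ G ∧
      IntegrableOn (fun z => ‖G z‖ ^ 2 * (1 - ‖z‖ ^ 2) ^ α) (Metric.ball 0 1) ∧
      ∫ z in Metric.ball (0 : ℂ) 1,
        ‖(starRingEnd ℂ) (Ψ z) * F z - G z‖ ^ 2 * (1 - ‖z‖ ^ 2) ^ α ≤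
      1 / ((2 + α) * Real.pi) * (∫ z in Metric.ball (0 : ℂ) 1, ‖deriv Ψ z‖ ^ 2) *
        (∫ z in Metric.ball (0 : ℂ) 1, ‖F z‖ ^ 2 * (1 - ‖z‖ ^ 2) ^ α) + ε := by
  obtain ⟨b, hb, hb'⟩ := exists_hasDiscSeries_deriv hΨ
  have ha := hasDiscSeries_taylor hF
  set a : ℕ → ℂ := fun n => ((n.factorial : ℂ))⁻¹ * iteratedDeriv n F 0
  have hD := sum_mul_norm_coeff_sq_le hΨ hb' hΨi
  obtain ⟨hEi, hE⟩ := ha.tendsto_integral_sub_discPoly hF.continuousOn hα hFi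
  have hs := ha.hasSum_integral hF.continuousOn hα hFi
  set I := ∫ z in Metric.ball (0 : ℂ) 1, ‖deriv Ψ z‖ ^ 2
  set J := ∫ z in Metric.ball (0 : ℂ) 1, ‖F z‖ ^ 2 * (1 - ‖z‖ ^ 2) ^ α
  have hI : 0 ≤ I := integral_nonneg fun z => sq_nonneg _
  have hJ : 0 ≤ J := setIntegral_nonneg Metric.isOpen_ball.measurableSet fun z hz =>
    mul_nonneg (sq_nonneg _) (one_sub_norm_sq_rpow_nonneg hz α)
  have hpi := Real.pi_pos
  have h2α : 0 < 2 + α := by linarith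
  set K := 1 / ((2 + α) * Real.pi) * I with hK
  have hK0 : 0 ≤ K := by positivity
  set δ := ε / (2 * (K * J + 1)) with hδ
  have hδ0 : 0 < δ := by positivity
  have hδK : δ * (K * J) ≤ ε / 2 := by
    rw [hδ, div_mul_eq_mul_div, div_le_div_iff₀ (by positivity) (by norm_num)]
    nlinarith [mul_nonneg hK0 hJ]
  have hE2 := hE.const_mul ((1 + 1 / δ) * C ^ 2)
  rw [mul_zero] at hE2
  obtain ⟨L, hL⟩ := (hE2.eventually (gt_mem_nhds (half_pos hε))).exists
  set P := discPoly a L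
  set G := discPoly (toeplitzCoeff (radialMoment α) b a L) L
  have hPc : Continuous P := continuous_discPoly _ _
  have hGc : Continuous G := continuous_discPoly _ _
  have hGi : IntegrableOn (fun z => ‖G z‖ ^ 2 * (1 - ‖z‖ ^ 2) ^ α) (Metric.ball 0 1) :=
    integrableOn_discPoly _ _ hα
  refine ⟨G, differentiable_discPoly _ _, hGi, ?_⟩
  have hΨc := Complex.continuous_conj.comp_continuousOn hΨ.continuousOn
  have hCc : ∀ z ∈ Metric.ball (0 : ℂ) 1, ‖((starRingEnd ℂ) ∘ Ψ) z‖ ≤ C := by simpa using hC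
  have hN : ∫ z in Metric.ball (0 : ℂ) 1,
      ‖(starRingEnd ℂ) (Ψ z) * P z - G z‖ ^ 2 * (1 - ‖z‖ ^ 2) ^ α ≤ K * J := by
    refine (integral_conj_mul_discPoly_sub_le hα hΨ.continuousOn hb hC hD a L).trans ?_
    have h1 := sum_le_hasSum (Finset.range L) (fun n _ => by
      have := (radialMoment_pos hα n).le; positivity) hs
    rw [← Finset.mul_sum] at h1
    calc _ = K * (2 * Real.pi * ∑ n ∈ Finset.range L, ‖a n‖ ^ 2 * radialMoment α n) := by
          rw [hK]; field_simp
      _ ≤ _ := mul_le_mul_of_nonneg_left h1 hK0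
  have hxi : IntegrableOn (fun z => ‖(starRingEnd ℂ) (Ψ z) * P z - G z‖ ^ 2 *
      (1 - ‖z‖ ^ 2) ^ α) (Metric.ball 0 1) := by
    have h := IntegrableOn.add_disc (hΨc.mul hPc.continuousOn) hGc.neg.continuousOn
      (IntegrableOn.bounded_mul_disc hΨc hPc.continuousOn hCc (integrableOn_discPoly a L hα))
      (by simpa using hGi)
    simpa [sub_eq_add_neg] using h
  have hle : ∫ z in Metric.ball (0 : ℂ) 1,
      ‖(starRingEnd ℂ) (Ψ z) * F z - G z‖ ^ 2 * (1 - ‖z‖ ^ 2) ^ α ≤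
      ∫ z in Metric.ball (0 : ℂ) 1,
        ((1 + δ) * (‖(starRingEnd ℂ) (Ψ z) * P z - G z‖ ^ 2 * (1 - ‖z‖ ^ 2) ^ α) +
        (1 + 1 / δ) * C ^ 2 * (‖F z - P z‖ ^ 2 * (1 - ‖z‖ ^ 2) ^ α)) := by
    refine integral_mono_of_nonneg
      ((ae_restrict_iff' Metric.isOpen_ball.measurableSet).2
        (Filter.Eventually.of_forall fun z hz =>
          mul_nonneg (sq_nonneg _) (one_sub_norm_sq_rpow_nonneg hz α)))
      ((hxi.const_mul _).add ((hEi L).const_mul _))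
      ((ae_restrict_iff' Metric.isOpen_ball.measurableSet).2
        (Filter.Eventually.of_forall fun z hz => ?_))
    have h0 := one_sub_norm_sq_rpow_nonneg hz α
    have h1 := norm_add_sq_le_of_pos ((starRingEnd ℂ) (Ψ z) * P z - G z)
      ((starRingEnd ℂ) (Ψ z) * (F z - P z)) hδ0
    have h2 : ‖(starRingEnd ℂ) (Ψ z) * (F z - P z)‖ ^ 2 ≤ C ^ 2 * ‖F z - P z‖ ^ 2 := by
      rw [norm_mul, mul_pow, Complex.norm_conj]
      exact mul_le_mul_of_nonneg_right (pow_le_pow_left₀ (norm_nonneg _) (hC z hz) 2)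
        (sq_nonneg _)
    have h3 : 0 ≤ 1 + 1 / δ := by positivity
    have h4 : (starRingEnd ℂ) (Ψ z) * P z - G z + (starRingEnd ℂ) (Ψ z) * (F z - P z) =
        (starRingEnd ℂ) (Ψ z) * F z - G z := by ring
    rw [h4] at h1
    have h5 := mul_le_mul_of_nonneg_right
      (h1.trans (add_le_add_right (mul_le_mul_of_nonneg_left h2 h3) _)) h0
    refine h5.trans_eq ?_
    ring
  rw [integral_add (hxi.const_mul _) ((hEi L).const_mul _), integral_const_mul,
    integral_const_mul] at hle
  have h6 := mul_le_mul_of_nonneg_left hN (by positivity : 0 ≤ 1 + δ)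
  have h7 : (1 + δ) * (K * J) = K * J + δ * (K * J) := by ring
  linarith

section Conformal

variable {φ τ : ℂ → ℂ} {Ω B : Set ℂ}

lemma not_eventually_eq_of_injOn (hΩ : IsOpen Ω) (hinj : Set.InjOn φ Ω) {z₀ : ℂ} (hz₀ : z₀ ∈ Ω) :
    ¬ ∀ᶠ z in nhds z₀, φ z = φ z₀ := by
  intro h
  have h1 : ∀ᶠ z in nhdsWithin z₀ {z₀}ᶜ, z = z₀ := by
    filter_upwards [nhdsWithin_le_nhds h, nhdsWithin_le_nhds (hΩ.mem_nhds hz₀)] with z hz hzΩ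
    exact hinj hzΩ hz₀ hz
  obtain ⟨z, hz, hz'⟩ := (h1.and self_mem_nhdsWithin).exists
  exact hz' hz

lemma continuousAt_of_leftInvOn (hΩ : IsOpen Ω) (hφ : DifferentiableOn ℂ φ Ω)
    (hinj : Set.InjOn φ Ω) (hl : Set.LeftInvOn τ φ Ω) {z₀ : ℂ} (hz₀ : z₀ ∈ Ω) :
    ContinuousAt τ (φ z₀) := by
  have h1 := ((hφ.analyticAt (hΩ.mem_nhds hz₀)).eventually_constant_or_nhds_le_map_nhds
    ).resolve_left (not_eventually_eq_of_injOn hΩ hinj hz₀)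
  intro V hV
  rw [hl hz₀] at hV
  have h2 := h1 (Filter.image_mem_map (m := φ) (Filter.inter_mem hV (hΩ.mem_nhds hz₀)))
  refine Filter.mem_map.2 (Filter.mem_of_superset h2 ?_)
  rintro _ ⟨z, ⟨hzV, hzΩ⟩, rfl⟩
  simpa [hl hzΩ] using hzV

lemma eventually_deriv_ne_zero_of_injOn (hΩ : IsOpen Ω) (hφ : DifferentiableOn ℂ φ Ω)
    (hinj : Set.InjOn φ Ω) {z₀ : ℂ} (hz₀ : z₀ ∈ Ω) :
    ∀ᶠ z in nhdsWithin z₀ {z₀}ᶜ, deriv φ z ≠ 0 := by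
  refine ((hφ.analyticAt (hΩ.mem_nhds hz₀)).deriv.eventually_eq_zero_or_eventually_ne_zero
    ).resolve_left fun h => not_eventually_eq_of_injOn hΩ hinj hz₀ ?_
  obtain ⟨r, hr, hball⟩ := Metric.eventually_nhds_iff_ball.1 (h.and (hΩ.mem_nhds hz₀))
  refine Metric.eventually_nhds_iff_ball.2 ⟨r, hr, fun z hz => ?_⟩
  exact Metric.isOpen_ball.is_const_of_deriv_eq_zero (convex_ball z₀ r).isPreconnected
    (hφ.mono fun x hx => (hball x hx).2) (fun x hx => (hball x hx).1) hz (Metric.mem_ball_self hr)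

lemma analyticAt_of_invOn (hΩ : IsOpen Ω) (hB : IsOpen B) (hφ : DifferentiableOn ℂ φ Ω)
    (hmaps : Set.MapsTo φ Ω B) (hinv : Set.InvOn τ φ Ω B) {z₀ : ℂ} (hz₀ : z₀ ∈ Ω) :
    AnalyticAt ℂ τ (φ z₀) := by
  have hinj : Set.InjOn φ Ω := hinv.1.injOn
  have hcont := continuousAt_of_leftInvOn hΩ hφ hinj hinv.1 hz₀
  have hBn : B ∈ nhds (φ z₀) := hB.mem_nhds (hmaps hz₀)
  have ht : Filter.Tendsto τ (nhdsWithin (φ z₀) {φ z₀}ᶜ) (nhdsWithin z₀ {z₀}ᶜ) := by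
    refine tendsto_nhdsWithin_iff.2 ⟨?_, ?_⟩
    · have := hcont.tendsto.mono_left (nhdsWithin_le_nhds (s := {φ z₀}ᶜ))
      rwa [hinv.1 hz₀] at this
    · filter_upwards [self_mem_nhdsWithin, nhdsWithin_le_nhds hBn] with u hu huB h
      exact hu (by rw [← hinv.2 huB, Set.mem_singleton_iff.1 h]; rfl)
  refine analyticAt_of_differentiable_on_punctured_nhds_of_continuousAt ?_ hcont
  filter_upwards [ht.eventually (eventually_deriv_ne_zero_of_injOn hΩ hφ hinj hz₀),
    ht.eventually (nhdsWithin_le_nhds (hΩ.mem_nhds hz₀)), nhdsWithin_le_nhds hBn] with u hu huΩ huB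
  have hc := continuousAt_of_leftInvOn hΩ hφ hinj hinv.1 huΩ
  rw [hinv.2 huB] at hc
  exact (HasDerivAt.of_local_left_inverse hc
    (hφ.differentiableAt (hΩ.mem_nhds huΩ)).hasDerivAt hu
    (Filter.mem_of_superset (hB.mem_nhds huB) fun v hv => hinv.2 hv)).differentiableAt

lemma deriv_ne_zero_of_invOn (hΩ : IsOpen Ω) (hB : IsOpen B) (hφ : DifferentiableOn ℂ φ Ω)
    (hmaps : Set.MapsTo φ Ω B) (hinv : Set.InvOn τ φ Ω B) {z₀ : ℂ} (hz₀ : z₀ ∈ Ω) :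
    deriv φ z₀ ≠ 0 := by
  have h1 := (analyticAt_of_invOn hΩ hB hφ hmaps hinv hz₀).differentiableAt.hasDerivAt
  have h2 := h1.comp z₀ (hφ.differentiableAt (hΩ.mem_nhds hz₀)).hasDerivAt
  have h3 : τ ∘ φ =ᶠ[nhds z₀] id :=
    Filter.mem_of_superset (hΩ.mem_nhds hz₀) fun z hz => hinv.1 hz
  have h4 := (h2.congr_of_eventuallyEq h3.symm).unique (hasDerivAt_id z₀)
  exact right_ne_zero_of_mul_eq_one h4

lemma differentiableOn_of_exp_comp_eq {g L : ℂ → ℂ} (hΩ : IsOpen Ω)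
    (hg : DifferentiableOn ℂ g Ω) (hL : ContinuousOn L Ω)
    (hexp : Set.EqOn (Complex.exp ∘ L) g Ω) : DifferentiableOn ℂ L Ω := by
  intro z₀ hz₀
  have hn := hΩ.mem_nhds hz₀
  have hg0 : g z₀ ≠ 0 := by rw [← hexp hz₀]; exact Complex.exp_ne_zero _
  have hd : DifferentiableAt ℂ (fun z => L z₀ + Complex.log (g z / g z₀)) z₀ := by
    refine DifferentiableAt.const_add _ (DifferentiableAt.clog ?_ ?_)
    · exact (hg.differentiableAt hn).div_const _
    · rw [div_self hg0]; exact Complex.one_mem_slitPlane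
  refine (hd.congr_of_eventuallyEq ?_).differentiableWithinAt
  have hc : ContinuousAt (fun z => (L z - L z₀).im) z₀ :=
    Complex.continuous_im.continuousAt.comp ((hL.continuousAt hn).sub continuousAt_const)
  have h0 : (L z₀ - L z₀).im = 0 := by simp
  have h1 : ∀ᶠ z in nhds z₀, (L z - L z₀).im ∈ Set.Ioo (-Real.pi) Real.pi :=
    hc.eventually_mem (by rw [h0]; exact Ioo_mem_nhds (by linarith [Real.pi_pos]) Real.pi_pos)
  filter_upwards [h1, hn] with z hz hzΩ
  have h2 : g z / g z₀ = Complex.exp (L z - L z₀) := by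
    rw [Complex.exp_sub, ← hexp hzΩ, ← hexp hz₀]; rfl
  rw [h2, Complex.log_exp hz.1 hz.2.le]
  ring

lemma exists_differentiableOn_norm_sq_eq_rpow {g : ℂ → ℂ} (hΩ : IsOpen Ω)
    (hsc : IsSimplyConnected Ω) (hg : DifferentiableOn ℂ g Ω) (hg0 : ∀ z ∈ Ω, g z ≠ 0) (β : ℝ) :
    ∃ κ : ℂ → ℂ, DifferentiableOn ℂ κ Ω ∧ (∀ z, κ z ≠ 0) ∧
      ∀ z ∈ Ω, ‖κ z‖ ^ 2 = ‖g z‖ ^ β := by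
  obtain ⟨L, hLc, hL⟩ := Complex.exists_continuousOn_eqOn_exp_comp hsc hΩ hg.continuousOn
    (by rintro ⟨z, hz, h⟩; exact hg0 z hz h)
  have hLd := differentiableOn_of_exp_comp_eq hΩ hg hLc hL
  refine ⟨fun z => Complex.exp ((β / 2 : ℝ) * L z), (hLd.const_mul _).cexp,
    fun z => Complex.exp_ne_zero _, fun z hz => ?_⟩
  rw [← hL hz, Function.comp_apply, Complex.norm_exp, Complex.norm_exp, ← Real.exp_mul,
    ← Real.exp_nat_mul, Complex.re_ofReal_mul]
  congr 1
  push_cast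
  ring

lemma abs_det_restrictScalars_smulRight (c : ℂ) :
    |((ContinuousLinearMap.toSpanSingleton ℂ c).restrictScalars ℝ).det| = ‖c‖ ^ 2 := by
  simp [ContinuousLinearMap.det, LinearMap.det_restrictScalars, Algebra.norm_complex_eq,
    Complex.normSq_eq_norm_sq]

lemma hasFDerivWithinAt_real (hΩ : IsOpen Ω) (hφ : DifferentiableOn ℂ φ Ω) {z : ℂ} (hz : z ∈ Ω) :
    HasFDerivWithinAt φ ((ContinuousLinearMap.toSpanSingleton ℂ (deriv φ z)).restrictScalars ℝ)
      Ω z :=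
  ((hφ.differentiableAt (hΩ.mem_nhds hz)).hasDerivAt.hasFDerivAt.restrictScalars ℝ
    ).hasFDerivWithinAt

lemma setIntegral_of_bijOn (hΩ : IsOpen Ω) (hφ : DifferentiableOn ℂ φ Ω)
    (hbij : Set.BijOn φ Ω B) (h : ℂ → ℝ) :
    ∫ u in B, h u = ∫ z in Ω, ‖deriv φ z‖ ^ 2 * h (φ z) := by
  rw [← hbij.image_eq, integral_image_eq_integral_abs_det_fderiv_smul volume hΩ.measurableSet
    (fun z hz => hasFDerivWithinAt_real hΩ hφ hz) hbij.injOn]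
  simp only [abs_det_restrictScalars_smulRight, smul_eq_mul]

lemma integrableOn_of_bijOn_iff (hΩ : IsOpen Ω) (hφ : DifferentiableOn ℂ φ Ω)
    (hbij : Set.BijOn φ Ω B) (h : ℂ → ℝ) :
    IntegrableOn h B ↔ IntegrableOn (fun z => ‖deriv φ z‖ ^ 2 * h (φ z)) Ω := by
  rw [← hbij.image_eq, integrableOn_image_iff_integrableOn_abs_det_fderiv_smul volume
    hΩ.measurableSet (fun z hz => hasFDerivWithinAt_real hΩ hφ hz) hbij.injOn]
  simp only [abs_det_restrictScalars_smulRight, smul_eq_mul]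

end Conformal

/-- Putnam-type corollary on weighted Bergman spaces `A²_α(Ω)` of a bounded simply
connected domain `Ω` with Riemann map `φ : Ω → 𝔻` and weight
`w_α = (1+α)(1-|φ|²)^α/|φ'|^α`:  the weighted `L²`-distance from `conj(ψ)·f`
to `A²_α(Ω)` is at most `(1/((2+α)π)) ‖ψ'‖²_{A²(Ω)} ‖f‖²_α`. -/
theorem putnam_corollary_weighted_bergman_domain
    (α : ℝ) (hα : -1 < α)
    (Ω : Set ℂ) (hΩo : IsOpen Ω) (hΩne : Ω.Nonempty) (hΩb : Bornology.IsBounded Ω)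
    (hΩsc : SimplyConnectedSpace Ω)
    (φ : ℂ → ℂ) (hφ : DifferentiableOn ℂ φ Ω)
    (hφbij : Set.BijOn φ Ω (Metric.ball (0 : ℂ) 1))
    (w : ℂ → ℝ)
    (hw : ∀ z ∈ Ω, w z = (1 + α) * (1 - ‖φ z‖ ^ 2) ^ α / ‖deriv φ z‖ ^ α)
    (ψ : ℂ → ℂ) (hψ : DifferentiableOn ℂ ψ Ω) (hψb : ∃ C : ℝ, ∀ z ∈ Ω, ‖ψ z‖ ≤ C)
    (hψ'2 : IntegrableOn (fun z => ‖deriv ψ z‖ ^ 2) Ω volume)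
    (f : ℂ → ℂ) (hf : DifferentiableOn ℂ f Ω)
    (hf2 : IntegrableOn (fun z => ‖f z‖ ^ 2 * w z) Ω volume) :
    ⨅ g : {g : ℂ → ℂ // DifferentiableOn ℂ g Ω ∧
        IntegrableOn (fun z => ‖g z‖ ^ 2 * w z) Ω volume},
      ∫ z in Ω, ‖(starRingEnd ℂ) (ψ z) * f z - g.1 z‖ ^ 2 * w z ≤
    (1 / ((2 + α) * Real.pi)) * (∫ z in Ω, ‖deriv ψ z‖ ^ 2) *
      (∫ z in Ω, ‖f z‖ ^ 2 * w z) := by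
  have hBo : IsOpen (Metric.ball (0 : ℂ) 1) := Metric.isOpen_ball
  have hα1 : 0 < 1 + α := by linarith
  set τ := Function.invFunOn φ Ω
  have hinv : Set.InvOn τ φ Ω (Metric.ball 0 1) := hφbij.invOn_invFunOn
  have hτm : Set.MapsTo τ (Metric.ball 0 1) Ω := hφbij.surjOn.mapsTo_invFunOn
  have hτd : DifferentiableOn ℂ τ (Metric.ball 0 1) := fun u hu => by
    have := analyticAt_of_invOn hΩo hBo hφ hφbij.mapsTo hinv (hτm hu)
    rw [hinv.2 hu] at this
    exact this.differentiableAt.differentiableWithinAt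
  have hφ' : ∀ z ∈ Ω, deriv φ z ≠ 0 := fun z hz =>
    deriv_ne_zero_of_invOn hΩo hBo hφ hφbij.mapsTo hinv hz
  obtain ⟨κ, hκd, hκ0, hκ⟩ := exists_differentiableOn_norm_sq_eq_rpow hΩo hΩsc
    (hφ.deriv hΩo) hφ' (2 + α)
  have hpt : ∀ q Q : ℂ → ℂ, (∀ z ∈ Ω, q z = Q (φ z) * κ z) → ∀ z ∈ Ω,
      ‖deriv φ z‖ ^ 2 * (‖Q (φ z)‖ ^ 2 * (1 - ‖φ z‖ ^ 2) ^ α) =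
        (1 + α)⁻¹ * (‖q z‖ ^ 2 * w z) := by
    intro q Q hq z hz
    have hp : 0 < ‖deriv φ z‖ := norm_pos_iff.2 (hφ' z hz)
    have hpα := Real.rpow_pos_of_pos hp α
    rw [hq z hz, hw z hz, norm_mul, mul_pow, hκ z hz, Real.rpow_add hp, Real.rpow_two]
    field_simp
  have hint : ∀ q Q : ℂ → ℂ, (∀ z ∈ Ω, q z = Q (φ z) * κ z) →
      ∫ u in Metric.ball (0 : ℂ) 1, ‖Q u‖ ^ 2 * (1 - ‖u‖ ^ 2) ^ α =
        (1 + α)⁻¹ * ∫ z in Ω, ‖q z‖ ^ 2 * w z := by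
    intro q Q hq
    rw [setIntegral_of_bijOn hΩo hφ hφbij, ← integral_const_mul]
    exact setIntegral_congr_fun hΩo.measurableSet (hpt q Q hq)
  have hintble : ∀ q Q : ℂ → ℂ, (∀ z ∈ Ω, q z = Q (φ z) * κ z) →
      (IntegrableOn (fun u => ‖Q u‖ ^ 2 * (1 - ‖u‖ ^ 2) ^ α) (Metric.ball 0 1) ↔
        IntegrableOn (fun z => ‖q z‖ ^ 2 * w z) Ω) := by
    intro q Q hq
    rw [integrableOn_of_bijOn_iff hΩo hφ hφbij,
      integrableOn_congr_fun (hpt q Q hq) hΩo.measurableSet]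
    exact integrable_const_mul_iff (IsUnit.mk0 _ (inv_ne_zero hα1.ne')) _
  have hψτ : DifferentiableOn ℂ (ψ ∘ τ) (Metric.ball 0 1) := hψ.comp hτd hτm
  have hderiv : ∀ z ∈ Ω, ‖deriv φ z‖ ^ 2 * ‖deriv (ψ ∘ τ) (φ z)‖ ^ 2 = ‖deriv ψ z‖ ^ 2 := by
    intro z hz
    have h1 := (hψτ.differentiableAt (hBo.mem_nhds (hφbij.mapsTo hz))).hasDerivAt.comp z
      (hφ.differentiableAt (hΩo.mem_nhds hz)).hasDerivAt
    have h2 : (ψ ∘ τ) ∘ φ =ᶠ[nhds z] ψ :=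
      Filter.mem_of_superset (hΩo.mem_nhds hz) fun x hx => congrArg ψ (hinv.1 hx)
    rw [(h1.congr_of_eventuallyEq h2.symm).deriv, norm_mul, mul_pow, mul_comm]
  have hI : ∫ u in Metric.ball (0 : ℂ) 1, ‖deriv (ψ ∘ τ) u‖ ^ 2 = ∫ z in Ω, ‖deriv ψ z‖ ^ 2 := by
    rw [setIntegral_of_bijOn hΩo hφ hφbij]
    exact setIntegral_congr_fun hΩo.measurableSet hderiv
  have hIi : IntegrableOn (fun u => ‖deriv (ψ ∘ τ) u‖ ^ 2) (Metric.ball 0 1) := by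
    rw [integrableOn_of_bijOn_iff hΩo hφ hφbij,
      integrableOn_congr_fun hderiv hΩo.measurableSet]
    exact hψ'2
  have hF : ∀ z ∈ Ω, f z = f (τ (φ z)) / κ (τ (φ z)) * κ z := fun z hz => by
    rw [hinv.1 hz, div_mul_cancel₀ _ (hκ0 z)]
  obtain ⟨C, hC⟩ := hψb
  have hbdd : BddBelow (Set.range fun g : {g : ℂ → ℂ // DifferentiableOn ℂ g Ω ∧
      IntegrableOn (fun z => ‖g z‖ ^ 2 * w z) Ω volume} =>
      ∫ z in Ω, ‖(starRingEnd ℂ) (ψ z) * f z - g.1 z‖ ^ 2 * w z) := by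
    refine ⟨0, ?_⟩
    rintro _ ⟨g, rfl⟩
    refine setIntegral_nonneg hΩo.measurableSet fun z hz => mul_nonneg (sq_nonneg _) ?_
    rw [hw z hz]
    exact div_nonneg (mul_nonneg hα1.le (one_sub_norm_sq_rpow_nonneg (hφbij.mapsTo hz) α))
      (Real.rpow_nonneg (norm_nonneg _) _)
  refine le_of_forall_pos_le_add fun ε hε => ?_
  obtain ⟨G, hGd, hGi, hG⟩ := exists_integral_conj_mul_sub_le_add hα hψτ
    (fun u hu => hC _ (hτm hu)) hIi
    ((hf.comp hτd hτm).div (hκd.comp hτd hτm) fun u _ => hκ0 _)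
    ((hintble f (fun u => f (τ u) / κ (τ u)) hF).2 hf2) (div_pos hε hα1)
  refine (ciInf_le hbdd ⟨fun z => G (φ z) * κ z, (hGd.comp_differentiableOn hφ).mul hκd,
    (hintble _ G fun z _ => rfl).1 hGi⟩).trans ?_
  have e1 := hint f (fun u => f (τ u) / κ (τ u)) hF
  have e2 := hint (fun z => (starRingEnd ℂ) (ψ z) * f z - G (φ z) * κ z)
    (fun u => (starRingEnd ℂ) (ψ (τ u)) * (f (τ u) / κ (τ u)) - G u) fun z hz => by
      rw [sub_mul, mul_assoc, ← hF z hz, hinv.1 hz]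
  have h3 : (1 + α)⁻¹ * ∫ z in Ω, ‖(starRingEnd ℂ) (ψ z) * f z - G (φ z) * κ z‖ ^ 2 * w z ≤
      1 / ((2 + α) * Real.pi) * (∫ z in Ω, ‖deriv ψ z‖ ^ 2) *
        ((1 + α)⁻¹ * ∫ z in Ω, ‖f z‖ ^ 2 * w z) + ε / (1 + α) := by
    rw [← e1, ← e2, ← hI]
    exact hG
  refine le_of_mul_le_mul_left (h3.trans_eq ?_) (inv_pos.2 hα1)
  ring
end
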